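/- arXiv:2004.08802 — 2 statements merged into one kernel-verified Lean document; each statement's English description precedes it below -/
import Mathlib

section
/- Assume N ≥ 4 and p = 1 + 4/(N−3). There exists a_* ∈ [−∞, −α b₀) with the following property. For a ∈ ℝ let U(ρ) = U(ρ,a) be the C² solution of (PDE) with U(1) = b₀ and U′(1) = a, and let [1, ρ₊) be its forward maximal interval of existence. Then: (i) if a > 0 then ρ₊ < +∞ and U(ρ) > b₀ for all ρ ∈ (1, ρ₊); (ii) if a_* < a < 0 then ρ₊ = +∞, 0 < U(ρ) < b₀ and U′(ρ) < 0 for all ρ > 1, and there exists L > 0 such that ρ^α U(ρ) → L and ρ^{α+1} U′(ρ) → −αL as ρ → +∞. -/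
open Set Filter

noncomputable def alphaP (p : ℝ) : ℝ := 2 / (p - 1)

noncomputable def b0 (p : ℝ) : ℝ := (2 * (p + 1) / (p - 1) ^ 2) ^ ((1 : ℝ) / (p - 1))

noncomputable def bInf (N : ℕ) (p : ℝ) : ℝ :=
  (alphaP p * ((N : ℝ) - 2 - alphaP p)) ^ (alphaP p / 2)

noncomputable def uInf (N : ℕ) (p : ℝ) (ρ : ℝ) : ℝ := bInf N p * ρ ^ (-(alphaP p))

/-- `u` solves `(1-ρ²)u'' + ((N-1)/ρ - 2(α+1)ρ)u' - α(α+1)u + |u|^{p-1}u = 0` on `s`. -/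
def IsSolOn (N : ℕ) (p : ℝ) (u : ℝ → ℝ) (s : Set ℝ) : Prop :=
  ∀ ρ ∈ s,
    (1 - ρ ^ 2) * deriv (deriv u) ρ
      + (((N : ℝ) - 1) / ρ - 2 * (alphaP p + 1) * ρ) * deriv u ρ
      - alphaP p * (alphaP p + 1) * u ρ + |u ρ| ^ (p - 1) * u ρ = 0

theorem uIcc_one_subset_Ioi {r : ℝ} (hr : 0 < r) : uIcc 1 r ⊆ Ioi (0 : ℝ) := fun _ hx =>
  lt_of_lt_of_le (lt_min one_pos hr) hx.1

theorem intervalIntegrable_one_of_continuousOn_Ioi {f : ℝ → ℝ} (hf : ContinuousOn f (Ioi 0))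
    {r : ℝ} (hr : 0 < r) : IntervalIntegrable f MeasureTheory.volume 1 r :=
  (hf.mono (uIcc_one_subset_Ioi hr)).intervalIntegrable

theorem hasDerivAt_integral_one {f : ℝ → ℝ} (hf : ContinuousOn f (Ioi 0)) {r : ℝ} (hr : 0 < r) :
    HasDerivAt (fun x => ∫ s in (1 : ℝ)..x, f s) (f r) r :=
  intervalIntegral.integral_hasDerivAt_right (intervalIntegrable_one_of_continuousOn_Ioi hf hr)
    (hf.stronglyMeasurableAtFilter isOpen_Ioi r hr) (hf.continuousAt (Ioi_mem_nhds hr))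

theorem continuousOn_integral_one {f : ℝ → ℝ} (hf : ContinuousOn f (Ioi 0)) :
    ContinuousOn (fun x => ∫ s in (1 : ℝ)..x, f s) (Ioi 0) := fun _ hr =>
  (hasDerivAt_integral_one hf hr).continuousAt.continuousWithinAt

/-- The weight `exp (2 |∫₁ʳ K|)`, which turns a singular integral operator into a contraction. -/
noncomputable def expWeight (K : ℝ → ℝ) (r : ℝ) : ℝ := Real.exp (2 * |∫ s in (1 : ℝ)..r, K s|)

theorem one_le_expWeight (K : ℝ → ℝ) (r : ℝ) : 1 ≤ expWeight K r :=
  Real.one_le_exp (by positivity)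

theorem continuousOn_expWeight {K : ℝ → ℝ} (hK : ContinuousOn K (Ioi 0)) :
    ContinuousOn (expWeight K) (Ioi 0) :=
  Real.continuous_exp.comp_continuousOn (continuousOn_const.mul (continuousOn_integral_one hK).abs)

theorem expWeight_le {K : ℝ → ℝ} (hK : ContinuousOn K (Ioi 0)) (hK0 : ∀ s, 0 ≤ K s) {r s : ℝ}
    (hr : 0 < r) (hs : s ∈ uIcc 1 r) : expWeight K s ≤ expWeight K r := by
  refine Real.exp_le_exp.2 (mul_le_mul_of_nonneg_left ?_ zero_le_two)
  refine intervalIntegral.abs_integral_mono_interval ?_ (Eventually.of_forall hK0)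
    (intervalIntegrable_one_of_continuousOn_Ioi hK hr)
  intro x hx
  rcases le_total 1 r with h | h
  · rw [uIcc_of_le h] at hs
    rw [uIoc_of_le hs.1] at hx
    rw [uIoc_of_le h]
    exact ⟨hx.1, hx.2.trans hs.2⟩
  · rw [uIcc_of_ge h] at hs
    rw [uIoc_of_ge hs.2] at hx
    rw [uIoc_of_ge h]
    exact ⟨hs.1.trans_lt hx.1, hx.2⟩

theorem abs_integral_mul_expWeight_le {K : ℝ → ℝ} (hK : ContinuousOn K (Ioi 0))
    (hK0 : ∀ s, 0 ≤ K s) {r : ℝ} (hr : 0 < r) :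
    |∫ s in (1 : ℝ)..r, K s * expWeight K s| ≤ expWeight K r / 2 := by
  have key : ∀ ε : ℝ, (∀ s ∈ uIcc 1 r, |∫ t in (1 : ℝ)..s, K t| = ε * ∫ t in (1 : ℝ)..s, K t) →
      ε * ε = 1 →
      (∫ s in (1 : ℝ)..r, K s * expWeight K s) = ε * (expWeight K r - 1) / 2 := by
    intro ε hε hε2
    have h1 : (∫ s in (1 : ℝ)..r, K s * expWeight K s) =
        ∫ s in (1 : ℝ)..r, K s * Real.exp (2 * (ε * ∫ t in (1 : ℝ)..s, K t)) :=
      intervalIntegral.integral_congr fun s hs => by simp only [expWeight, hε s hs]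
    have h2 : ∀ s ∈ uIcc 1 r, HasDerivAt
        (fun s => ε / 2 * Real.exp (2 * (ε * ∫ t in (1 : ℝ)..s, K t)))
        (K s * Real.exp (2 * (ε * ∫ t in (1 : ℝ)..s, K t))) s := by
      intro s hs
      have := ((((hasDerivAt_integral_one hK (uIcc_one_subset_Ioi hr hs)).const_mul ε).const_mul
        2).exp).const_mul (ε / 2)
      refine this.congr_deriv ?_
      linear_combination (K s * Real.exp (2 * (ε * ∫ t in (1 : ℝ)..s, K t))) * hε2
    rw [h1, intervalIntegral.integral_eq_sub_of_hasDerivAt h2]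
    · rw [expWeight, hε r right_mem_uIcc]
      simp
      ring
    · refine ContinuousOn.intervalIntegrable ?_
      refine ((hK.mul (Real.continuous_exp.comp_continuousOn (continuousOn_const.mul
        (continuousOn_const.mul (continuousOn_integral_one hK)))))).mono (uIcc_one_subset_Ioi hr)
  have h1 := one_le_expWeight K r
  rcases le_total 1 r with h | h
  · rw [key 1 (fun s hs => ?_) (by norm_num), abs_of_nonneg (by linarith)]
    · linarith
    · rw [uIcc_of_le h] at hs
      rw [one_mul, abs_of_nonneg (intervalIntegral.integral_nonneg hs.1 fun u _ => hK0 u)]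
  · rw [key (-1) (fun s hs => ?_) (by norm_num), abs_of_nonpos (by linarith)]
    · linarith
    · rw [uIcc_of_ge h] at hs
      rw [intervalIntegral.integral_symm,
        abs_of_nonpos (neg_nonpos.2 (intervalIntegral.integral_nonneg hs.2 fun u _ => hK0 u))]
      ring

/-- Global existence on `(0, ∞)` for `(1 - s²) v'' = F(s, v)` with data prescribed at the regular
singular point `s = 1`, where `F` vanishes. -/
theorem exists_solution_singular_one (F : ℝ → ℝ → ℝ) (K : ℝ → ℝ) (b m : ℝ)
    (hK : ContinuousOn K (Ioi 0)) (hK0 : ∀ s, 0 ≤ K s) (hFb : ∀ s, 0 < s → F s b = 0)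
    (hLip : ∀ s, 0 < s → ∀ x y, |F s x - F s y| ≤ K s * |x - y|)
    (hFc : ∀ v : ℝ → ℝ, ContinuousOn v (Ioi 0) → ContinuousOn (fun s => F s (v s)) (Ioi 0))
    (hFd : ∀ v : ℝ → ℝ, DifferentiableAt ℝ v 1 → v 1 = b →
      DifferentiableAt ℝ (fun s => F s (v s)) 1) :
    ∃ v y h : ℝ → ℝ, v 1 = b ∧ y 1 = m ∧ (∀ r, 0 < r → HasDerivAt v (y r) r) ∧
      (∀ r, 0 < r → HasDerivAt y (h r) r) ∧ ContinuousOn h (Ioi 0) ∧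
      ∀ r, 0 < r → (1 - r ^ 2) * h r = F r (v r) := by
  classical
  set φ := expWeight K with hφ
  have hφ1 : ∀ r, 1 ≤ φ r := one_le_expWeight K
  have hφ0 : ∀ r, 0 < φ r := fun r => one_pos.trans_le (hφ1 r)
  have hφc : ContinuousOn φ (Ioi 0) := continuousOn_expWeight hK
  let Y : BoundedContinuousFunction ℝ ℝ → ℝ → ℝ := fun y r => φ r * y (Real.log r)
  have hY : ∀ y, ContinuousOn (Y y) (Ioi 0) := fun y =>
    hφc.mul (y.continuous.comp_continuousOn
      (Real.continuousOn_log.mono fun x hx => (ne_of_gt hx : x ≠ 0)))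
  let V : BoundedContinuousFunction ℝ ℝ → ℝ → ℝ := fun y r => b + ∫ s in (1 : ℝ)..r, Y y s
  have hV : ∀ y r, 0 < r → HasDerivAt (V y) (Y y r) r := fun y r hr =>
    (hasDerivAt_integral_one (hY y) hr).const_add b
  have hV1 : ∀ y, V y 1 = b := fun y => by simp [V]
  have hVc : ∀ y, ContinuousOn (V y) (Ioi 0) := fun y r hr =>
    (hV y r hr).continuousAt.continuousWithinAt
  let H : BoundedContinuousFunction ℝ ℝ → ℝ → ℝ :=
    fun y s => -(dslope (fun s => F s (V y s)) 1 s) / (1 + s)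
  have hH : ∀ y, ContinuousOn (H y) (Ioi 0) := fun y => by
    refine ContinuousOn.div ?_ (by fun_prop) (fun s hs => ?_)
    · refine ContinuousOn.neg ?_
      rw [continuousOn_dslope (Ioi_mem_nhds one_pos)]
      exact ⟨hFc _ (hVc y), hFd _ (hV y 1 one_pos).differentiableAt (hV1 y)⟩
    · have : (0 : ℝ) < s := hs
      positivity
  have hHe : ∀ y s, s ≠ 1 → H y s = -(F s (V y s)) / (s - 1) / (1 + s) := fun y s hs => by
    simp only [H]
    rw [dslope_of_ne _ hs, slope_def_field, hV1, hFb 1 one_pos, sub_zero, neg_div, neg_div,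
      neg_div]
  have hVd : ∀ y₁ y₂ s, 0 < s → |V y₁ s - V y₂ s| ≤ dist y₁ y₂ * φ s * |s - 1| := by
    intro y₁ y₂ s hs
    have h1 : V y₁ s - V y₂ s = ∫ t in (1 : ℝ)..s, (Y y₁ t - Y y₂ t) := by
      rw [intervalIntegral.integral_sub (intervalIntegrable_one_of_continuousOn_Ioi (hY y₁) hs)
        (intervalIntegrable_one_of_continuousOn_Ioi (hY y₂) hs)]
      simp only [V]
      ring
    rw [h1, ← Real.norm_eq_abs]
    refine intervalIntegral.norm_integral_le_of_norm_le_const fun t ht => ?_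
    have h2 : Y y₁ t - Y y₂ t = φ t * (y₁ (Real.log t) - y₂ (Real.log t)) := by
      simp only [Y]
      ring
    rw [h2, norm_mul, mul_comm, Real.norm_of_nonneg (hφ0 t).le, ← dist_eq_norm]
    exact mul_le_mul (BoundedContinuousFunction.dist_coe_le_dist _)
      (expWeight_le hK hK0 hs (uIoc_subset_uIcc ht)) (hφ0 t).le dist_nonneg
  have hHd : ∀ y₁ y₂ s, 0 < s → s ≠ 1 → |H y₁ s - H y₂ s| ≤ dist y₁ y₂ * (K s * φ s) := by
    intro y₁ y₂ s hs hs1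
    have h0 : 0 < |s - 1| := abs_pos.2 (sub_ne_zero.2 hs1)
    have h1 : H y₁ s - H y₂ s = -(F s (V y₁ s) - F s (V y₂ s)) / ((s - 1) * (1 + s)) := by
      rw [hHe _ _ hs1, hHe _ _ hs1, div_div, div_div]
      ring
    have h2 : (0 : ℝ) < 1 + s := by linarith
    rw [h1, abs_div, abs_neg, abs_mul, abs_of_pos h2, div_le_iff₀ (by positivity)]
    have h3 := hLip s hs (V y₁ s) (V y₂ s)
    have h4 := mul_le_mul_of_nonneg_left (hVd y₁ y₂ s hs) (hK0 s)
    have h5 : 0 ≤ dist y₁ y₂ * (K s * φ s) * |s - 1| := by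
      have := hK0 s
      have := (hφ0 s).le
      positivity
    nlinarith
  have hInt : ∀ y₁ y₂ r, 0 < r →
      |(∫ s in (1 : ℝ)..r, H y₁ s) - ∫ s in (1 : ℝ)..r, H y₂ s| ≤ dist y₁ y₂ * (φ r / 2) := by
    intro y₁ y₂ r hr
    rw [← intervalIntegral.integral_sub (intervalIntegrable_one_of_continuousOn_Ioi (hH y₁) hr)
        (intervalIntegrable_one_of_continuousOn_Ioi (hH y₂) hr)]
    have h1 : |∫ s in (1 : ℝ)..r, (H y₁ s - H y₂ s)| ≤
        |∫ s in (1 : ℝ)..r, dist y₁ y₂ * (K s * φ s)| := by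
      rw [← Real.norm_eq_abs]
      refine intervalIntegral.norm_integral_le_abs_of_norm_le ?_
        (intervalIntegrable_one_of_continuousOn_Ioi (continuousOn_const.mul (hK.mul hφc)) hr)
      have h2 : ∀ᵐ s : ℝ ∂MeasureTheory.volume, s ≠ 1 := by
        simp [MeasureTheory.ae_iff]
      filter_upwards [MeasureTheory.ae_restrict_of_ae h2,
        MeasureTheory.ae_restrict_mem measurableSet_uIoc] with s hs1 hs
      exact hHd y₁ y₂ s (uIcc_one_subset_Ioi hr (uIoc_subset_uIcc hs)) hs1
    refine h1.trans ?_
    rw [intervalIntegral.integral_const_mul, abs_mul, abs_of_nonneg dist_nonneg]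
    exact mul_le_mul_of_nonneg_left (abs_integral_mul_expWeight_le hK hK0 hr) dist_nonneg
  have hV0 : ∀ s, V 0 s = b := fun s => by simp [V, Y]
  have hH0 : ∀ r, 0 < r → ∫ s in (1 : ℝ)..r, H 0 s = 0 := by
    intro r hr
    refine intervalIntegral.integral_zero_ae ?_
    have h2 : ∀ᵐ s : ℝ ∂MeasureTheory.volume, s ≠ 1 := by
      simp [MeasureTheory.ae_iff]
    filter_upwards [h2] with s hs1 hs
    rw [hHe _ _ hs1, hV0, hFb s (uIcc_one_subset_Ioi hr (uIoc_subset_uIcc hs))]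
    simp
  let T : BoundedContinuousFunction ℝ ℝ → BoundedContinuousFunction ℝ ℝ := fun y =>
    BoundedContinuousFunction.ofNormedAddCommGroup
      (fun t => (m + ∫ s in (1 : ℝ)..Real.exp t, H y s) / φ (Real.exp t))
      (by
        refine Continuous.div ?_ ?_ fun t => (hφ0 _).ne'
        · exact continuous_const.add ((continuousOn_integral_one (hH y)).comp_continuous
            Real.continuous_exp fun t => Real.exp_pos t)
        · exact hφc.comp_continuous Real.continuous_exp fun t => Real.exp_pos t)
      (|m| + dist y 0)
      (by
        intro t
        have h1 := hInt y 0 (Real.exp t) (Real.exp_pos t)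
        rw [hH0 _ (Real.exp_pos t), sub_zero] at h1
        have h3 := hφ1 (Real.exp t)
        have h4 : 0 < φ (Real.exp t) := hφ0 _
        rw [Real.norm_eq_abs, abs_div, abs_of_pos h4, div_le_iff₀ h4]
        have h5 := abs_add_le m (∫ s in (1 : ℝ)..Real.exp t, H y s)
        have h6 : 0 ≤ dist y 0 * φ (Real.exp t) := mul_nonneg dist_nonneg h4.le
        have h7 := mul_le_mul_of_nonneg_left h3 (abs_nonneg m)
        linarith)
  have hT : ContractingWith (1 / 2) T := by
    refine ⟨by rw [← NNReal.coe_lt_coe]; norm_num, LipschitzWith.of_dist_le_mul fun y₁ y₂ => ?_⟩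
    rw [BoundedContinuousFunction.dist_le (by positivity)]
    intro t
    have h1 := hInt y₁ y₂ (Real.exp t) (Real.exp_pos t)
    have h4 : 0 < φ (Real.exp t) := hφ0 _
    simp only [T, BoundedContinuousFunction.coe_ofNormedAddCommGroup]
    rw [Real.dist_eq, ← sub_div, add_sub_add_left_eq_sub, abs_div, abs_of_pos h4,
      div_le_iff₀ h4]
    refine h1.trans (le_of_eq ?_)
    push_cast
    ring
  obtain ⟨y, hy⟩ : ∃ y, T y = y := ⟨_, hT.fixedPoint_isFixedPt⟩
  have hYy : ∀ r, 0 < r → Y y r = m + ∫ s in (1 : ℝ)..r, H y s := by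
    intro r hr
    have h1 : y (Real.log r) = (m + ∫ s in (1 : ℝ)..r, H y s) / φ r := by
      conv_lhs => rw [← hy]
      simp only [T, BoundedContinuousFunction.coe_ofNormedAddCommGroup, Real.exp_log hr]
    simp only [Y]
    rw [h1, mul_div_cancel₀ _ (hφ0 r).ne']
  refine ⟨V y, Y y, H y, hV1 y, ?_, hV y, fun r hr => ?_, hH y, fun r hr => ?_⟩
  · rw [hYy 1 one_pos]
    simp
  · refine ((hasDerivAt_integral_one (hH y) hr).const_add m).congr_of_eventuallyEq ?_
    filter_upwards [Ioi_mem_nhds hr] with s hs using hYy s hs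
  · by_cases h1 : r = 1
    · subst h1
      rw [hV1, hFb 1 one_pos]
      ring
    · rw [hHe _ _ h1]
      have h2 : r - 1 ≠ 0 := sub_ne_zero.2 h1
      have h3 : 1 + r ≠ 0 := by positivity
      field_simp
      ring

theorem forall_pos_of_step_right {f : ℝ → ℝ} {a σ : ℝ} (hf : ContinuousOn f (Ioo a σ))
    (hstart : ∀ᶠ r in nhdsWithin a (Ioi a), 0 < f r)
    (hstep : ∀ r ∈ Ioo a σ, (∀ s ∈ Ioo a r, 0 < f s) → 0 < f r) : ∀ r ∈ Ioo a σ, 0 < f r := by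
  intro x hx
  by_contra hfx
  obtain ⟨δ, hδ, hδf⟩ := (mem_nhdsGT_iff_exists_Ioo_subset).1 hstart
  rw [mem_Ioi] at hδ
  have hxδ : δ ≤ x := by
    by_contra h
    exact hfx (hδf ⟨hx.1, not_le.1 h⟩)
  set S : Set ℝ := Icc ((a + δ) / 2) x ∩ f ⁻¹' Iic 0 with hS
  have hsub : Icc ((a + δ) / 2) x ⊆ Ioo a σ := fun z hz =>
    ⟨by linarith [hz.1], hz.2.trans_lt hx.2⟩
  have hSc : IsCompact S := by
    refine isCompact_Icc.of_isClosed_subset ?_ inter_subset_left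
    exact (hf.mono hsub).preimage_isClosed_of_isClosed isClosed_Icc isClosed_Iic
  obtain ⟨z, hz, hzmin⟩ := hSc.exists_isLeast ⟨x, ⟨by linarith, le_rfl⟩, not_lt.1 hfx⟩
  refine absurd (hstep z (hsub hz.1) fun s hs => ?_) (not_lt.2 hz.2)
  by_contra hfs
  rcases lt_or_ge s δ with h | h
  · exact hfs (hδf ⟨hs.1, h⟩)
  · exact absurd (hzmin ⟨⟨by linarith, hs.2.le.trans hz.1.2⟩, not_lt.1 hfs⟩) (not_le.2 hs.2)

theorem forall_pos_of_step_left {f : ℝ → ℝ} {a τ : ℝ} (hf : ContinuousOn f (Ioo τ a))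
    (hstart : ∀ᶠ r in nhdsWithin a (Iio a), 0 < f r)
    (hstep : ∀ r ∈ Ioo τ a, (∀ s ∈ Ioo r a, 0 < f s) → 0 < f r) : ∀ r ∈ Ioo τ a, 0 < f r := by
  have key := forall_pos_of_step_right (f := fun x => f (-x)) (a := -a) (σ := -τ)
    (hf.comp continuousOn_neg fun x hx => ⟨by linarith [hx.2], by linarith [hx.1]⟩)
    (tendsto_neg_nhdsGT_neg.eventually hstart)
    (fun r hr h => hstep (-r) ⟨by linarith [hr.2], by linarith [hr.1]⟩ fun s hs => by
      simpa using h (-s) ⟨by linarith [hs.2], by linarith [hs.1]⟩)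
  intro r hr
  simpa using key (-r) ⟨by linarith [hr.2], by linarith [hr.1]⟩

/-- The nonlinearity `|x|^{p-1} x - α(α+1) x`, where `p - 1 = 2 / α`. -/
noncomputable def nonlin (α x : ℝ) : ℝ := |x| ^ (2 / α) * x - α * (α + 1) * x

/-- The positive zero of `nonlin α`. -/
noncomputable def nonlinRoot (α : ℝ) : ℝ := (α * (α + 1)) ^ (α / 2)

section Nonlinearity

variable {α : ℝ}

theorem nonlinRoot_pos (hα : 0 < α) : 0 < nonlinRoot α := by
  unfold nonlinRoot
  positivity

theorem nonlinRoot_rpow (hα : 0 < α) : nonlinRoot α ^ (2 / α) = α * (α + 1) := by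
  unfold nonlinRoot
  rw [← Real.rpow_mul (by positivity), show α / 2 * (2 / α) = 1 by field_simp, Real.rpow_one]

theorem nonlin_nonlinRoot (hα : 0 < α) : nonlin α (nonlinRoot α) = 0 := by
  unfold nonlin
  rw [abs_of_pos (nonlinRoot_pos hα), nonlinRoot_rpow hα, sub_self]

theorem nonlin_of_pos {x : ℝ} (hx : 0 < x) :
    nonlin α x = x * (x ^ (2 / α) - α * (α + 1)) := by
  unfold nonlin
  rw [abs_of_pos hx]
  ring

theorem nonlin_nonneg (hα : 0 < α) {x : ℝ} (hx : nonlinRoot α ≤ x) : 0 ≤ nonlin α x := by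
  have h0 := (nonlinRoot_pos hα).trans_le hx
  rw [nonlin_of_pos h0, ← nonlinRoot_rpow hα]
  exact mul_nonneg h0.le (sub_nonneg.2
    (Real.rpow_le_rpow (nonlinRoot_pos hα).le hx (by positivity)))

theorem nonlin_pos (hα : 0 < α) {x : ℝ} (hx : nonlinRoot α < x) : 0 < nonlin α x := by
  have h0 := (nonlinRoot_pos hα).trans hx
  rw [nonlin_of_pos h0, ← nonlinRoot_rpow hα]
  exact mul_pos h0 (sub_pos.2
    (Real.rpow_lt_rpow (nonlinRoot_pos hα).le hx (by positivity)))

theorem nonlin_nonpos (hα : 0 < α) {x : ℝ} (hx0 : 0 < x) (hx : x ≤ nonlinRoot α) :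
    nonlin α x ≤ 0 := by
  rw [nonlin_of_pos hx0, ← nonlinRoot_rpow hα]
  exact mul_nonpos_of_nonneg_of_nonpos hx0.le (sub_nonpos.2
    (Real.rpow_le_rpow hx0.le hx (by positivity)))

theorem hasDerivAt_abs_rpow_mul_self {e : ℝ} (he : 0 < e) (x : ℝ) :
    HasDerivAt (fun x : ℝ => |x| ^ e * x) ((e + 1) * |x| ^ e) x := by
  rcases eq_or_ne x 0 with rfl | hx
  · rw [hasDerivAt_iff_tendsto_slope]
    have h1 : Tendsto (fun x : ℝ => |x| ^ e) (nhdsWithin 0 {0}ᶜ) (nhds (|(0 : ℝ)| ^ e)) :=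
      ((continuous_abs.rpow_const fun _ => Or.inr he.le).tendsto 0).mono_left nhdsWithin_le_nhds
    simp only [abs_zero, Real.zero_rpow he.ne', mul_zero] at h1 ⊢
    refine h1.congr' ?_
    filter_upwards [self_mem_nhdsWithin] with y hy
    rw [slope_def_field, mul_zero, sub_zero, sub_zero, mul_div_cancel_right₀ _ hy]
  · have hx' : 0 < |x| := abs_pos.2 hx
    have h1 := ((hasDerivAt_abs hx).rpow_const (p := e) (Or.inl hx'.ne')).mul (hasDerivAt_id x)
    refine h1.congr_deriv ?_
    have h2 : |x| ^ e = |x| ^ (e - 1) * |x| := by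
      rw [Real.rpow_sub_one hx'.ne', div_mul_cancel₀ _ hx'.ne']
    have h3 : (SignType.sign x : ℝ) * x = |x| := sign_mul_self x
    simp only [id]
    rw [mul_one, h2]
    linear_combination (e * |x| ^ (e - 1)) * h3

theorem hasDerivAt_nonlin (hα : 0 < α) (x : ℝ) :
    HasDerivAt (nonlin α) ((2 / α + 1) * |x| ^ (2 / α) - α * (α + 1)) x := by
  have := (hasDerivAt_abs_rpow_mul_self (e := 2 / α) (by positivity) x).sub
    ((hasDerivAt_id x).const_mul (α * (α + 1)))
  rw [mul_one] at this
  exact this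

theorem continuous_nonlin (hα : 0 < α) : Continuous (nonlin α) :=
  continuous_iff_continuousAt.2 fun x => (hasDerivAt_nonlin hα x).continuousAt

theorem abs_nonlin_sub_le (hα : 0 < α) {M x y : ℝ} (hx : |x| ≤ M) (hy : |y| ≤ M) :
    |nonlin α x - nonlin α y| ≤ ((2 / α + 1) * |M| ^ (2 / α) + α * (α + 1)) * |x - y| := by
  refine (convex_Icc (-M) M).norm_image_sub_le_of_norm_hasDerivWithin_le
    (f' := fun z => (2 / α + 1) * |z| ^ (2 / α) - α * (α + 1))
    (fun z _ => (hasDerivAt_nonlin hα z).hasDerivWithinAt) (fun z hz => ?_)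
    (abs_le.1 hy) (abs_le.1 hx)
  have h1 : |z| ≤ |M| := (abs_le.2 hz).trans (le_abs_self M)
  have h2 : |z| ^ (2 / α) ≤ |M| ^ (2 / α) :=
    Real.rpow_le_rpow (abs_nonneg z) h1 (by positivity)
  have h3 := Real.rpow_nonneg (abs_nonneg z) (2 / α)
  have h4 : 0 < 2 / α + 1 := by positivity
  have h5 : 0 < α * (α + 1) := by positivity
  rw [Real.norm_eq_abs, abs_le]
  constructor <;> nlinarith

/-- The potential of `nonlin α`, normalised to vanish at its minimum points `± nonlinRoot α`. -/
noncomputable def potential (α x : ℝ) : ℝ :=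
  (|x| ^ (2 / α + 2) - nonlinRoot α ^ (2 / α + 2)) / (2 / α + 2)
    - α * (α + 1) / 2 * (x ^ 2 - nonlinRoot α ^ 2)

theorem hasDerivAt_potential (hα : 0 < α) (x : ℝ) :
    HasDerivAt (potential α) (nonlin α x) x := by
  have he : 0 < 2 / α := by positivity
  have h1 := ((hasDerivAt_abs_rpow x (p := 2 / α + 2) (by linarith)).sub_const
    (nonlinRoot α ^ (2 / α + 2))).div_const (2 / α + 2)
  have h2 := ((hasDerivAt_pow 2 x).sub_const (nonlinRoot α ^ 2)).const_mul (α * (α + 1) / 2)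
  refine (h1.sub h2).congr_deriv ?_
  rw [add_sub_cancel_right]
  unfold nonlin
  have h3 : 2 / α + 2 ≠ 0 := by positivity
  simp
  field_simp

theorem potential_nonlinRoot (hα : 0 < α) : potential α (nonlinRoot α) = 0 := by
  unfold potential
  rw [abs_of_pos (nonlinRoot_pos hα)]
  simp

theorem potential_nonneg (hα : 0 < α) (x : ℝ) : 0 ≤ potential α x := by
  have hb := nonlinRoot_pos hα
  have hc := nonlinRoot_rpow hα
  unfold potential
  set b := nonlinRoot α
  have he : 0 < 1 / α := by positivity
  have h1 := one_add_mul_self_le_rpow_one_add (s := x ^ 2 / b ^ 2 - 1) (p := 1 / α + 1)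
    (by linarith [show 0 ≤ x ^ 2 / b ^ 2 by positivity]) (by linarith)
  have h2 : (1 + (x ^ 2 / b ^ 2 - 1)) ^ (1 / α + 1) = |x| ^ (2 / α + 2) / b ^ (2 / α + 2) := by
    rw [add_sub_cancel, ← sq_abs x, ← div_pow, ← Real.div_rpow (abs_nonneg x) hb.le,
      ← Real.rpow_natCast, ← Real.rpow_mul (by positivity)]
    congr 1
    push_cast
    ring
  have h3 : b ^ (2 / α + 2) = α * (α + 1) * b ^ 2 := by
    rw [Real.rpow_add hb, hc]
    norm_cast
  rw [h2, le_div_iff₀ (by positivity)] at h1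
  rw [h3] at h1 ⊢
  have h4 : (0 : ℝ) < 2 / α + 2 := by positivity
  have h5 : (1 + (1 / α + 1) * (x ^ 2 / b ^ 2 - 1)) * (α * (α + 1) * b ^ 2) =
      α * (α + 1) * b ^ 2 + (2 / α + 2) * (α * (α + 1) / 2 * (x ^ 2 - b ^ 2)) := by
    field_simp
  rw [sub_nonneg, le_div_iff₀ h4]
  linarith

end Nonlinearity

theorem abs_max_neg_min_le {M x : ℝ} (hM : 0 ≤ M) : |max (-M) (min x M)| ≤ M :=
  abs_le.2 ⟨le_max_left _ _, max_le (by linarith) (min_le_right _ _)⟩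

theorem max_neg_min_eq_self {M x : ℝ} (hx : |x| ≤ M) : max (-M) (min x M) = x := by
  rw [min_eq_left (abs_le.1 hx).2, max_eq_right (abs_le.1 hx).1]

theorem abs_max_neg_min_sub_le (M x y : ℝ) :
    |max (-M) (min x M) - max (-M) (min y M)| ≤ |x - y| :=
  (abs_max_sub_max_le_max _ _ _ _).trans <| by
    rw [sub_self, abs_zero, max_eq_right (abs_nonneg _)]
    refine (abs_min_sub_min_le_max _ _ _ _).trans ?_
    rw [sub_self, abs_zero, max_eq_left (abs_nonneg _)]

/-- Global solvability of the equation whose nonlinearity is truncated at the level `M`. -/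
theorem exists_truncated_solution {α : ℝ} (hα : 0 < α) (m : ℝ) {M : ℝ → ℝ}
    (hM : ContinuousOn M (Ioi 0)) (hMb : ∀ s, 0 < s → nonlinRoot α < M s) :
    ∃ v y h : ℝ → ℝ, v 1 = nonlinRoot α ∧ y 1 = m ∧ (∀ r, 0 < r → HasDerivAt v (y r) r) ∧
      (∀ r, 0 < r → HasDerivAt y (h r) r) ∧ ContinuousOn h (Ioi 0) ∧
      ∀ r, 0 < r → |v r| ≤ M r → (1 - r ^ 2) * h r = nonlin α (v r) := by
  have hb := nonlinRoot_pos hα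
  obtain ⟨v, y, h, h1, h2, h3, h4, h5, h6⟩ := exists_solution_singular_one
    (fun s x => nonlin α (max (-M s) (min x (M s))))
    (fun s => (2 / α + 1) * |M s| ^ (2 / α) + α * (α + 1)) (nonlinRoot α) m
    ((continuousOn_const.mul (hM.abs.rpow_const fun _ _ => Or.inr (by positivity))).add
      continuousOn_const) (fun s => by positivity)
    (fun s hs => by
      rw [max_neg_min_eq_self (by rw [abs_of_pos hb]; exact (hMb s hs).le),
        nonlin_nonlinRoot hα])
    (fun s hs x z => by
      have hM0 : 0 ≤ M s := (hb.trans (hMb s hs)).le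
      exact (abs_nonlin_sub_le hα (abs_max_neg_min_le hM0) (abs_max_neg_min_le hM0)).trans
        (mul_le_mul_of_nonneg_left (abs_max_neg_min_sub_le _ _ _) (by positivity)))
    (fun v hv => (continuous_nonlin hα).comp_continuousOn (hM.neg.sup (hv.inf hM)))
    (fun v hv hv1 => by
      have h1 : DifferentiableAt ℝ (fun s => nonlin α (v s)) 1 :=
        ((hasDerivAt_nonlin hα (v 1)).differentiableAt).comp (1 : ℝ) hv
      refine h1.congr_of_eventuallyEq ?_
      have h2 : ∀ᶠ s in nhds (1 : ℝ), |v s| < M s := by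
        refine (hv.continuousAt.abs).eventually_lt (hM.continuousAt (Ioi_mem_nhds one_pos)) ?_
        rw [hv1, abs_of_pos hb]
        exact hMb 1 one_pos
      filter_upwards [h2] with s hs
      rw [max_neg_min_eq_self hs.le])
  exact ⟨v, y, h, h1, h2, h3, h4, h5, fun r hr hvr => by
    rw [h6 r hr, max_neg_min_eq_self hvr]⟩

theorem monotoneOn_Icc_of_hasDerivAt {f f' : ℝ → ℝ} {a b : ℝ}
    (hf : ∀ x ∈ Icc a b, HasDerivAt f (f' x) x) (h : ∀ x ∈ Ioo a b, 0 ≤ f' x) :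
    MonotoneOn f (Icc a b) := by
  refine monotoneOn_of_deriv_nonneg (convex_Icc a b)
    (fun x hx => (hf x hx).continuousAt.continuousWithinAt)
    (fun x hx => (hf x (interior_subset hx)).differentiableAt.differentiableWithinAt)
    fun x hx => ?_
  rw [(hf x (interior_subset hx)).deriv]
  exact h x (by rwa [interior_Icc] at hx)

theorem antitoneOn_Icc_of_hasDerivAt {f f' : ℝ → ℝ} {a b : ℝ}
    (hf : ∀ x ∈ Icc a b, HasDerivAt f (f' x) x) (h : ∀ x ∈ Ioo a b, f' x ≤ 0) :
    AntitoneOn f (Icc a b) := by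
  have := (monotoneOn_Icc_of_hasDerivAt (fun x hx => (hf x hx).neg)
    fun x hx => neg_nonneg.2 (h x hx)).neg
  simpa using this

theorem HasDerivAt.eventually_lt_right {f : ℝ → ℝ} {f' x : ℝ} (hf : HasDerivAt f f' x)
    (h : 0 < f') : ∀ᶠ z in nhdsWithin x (Ioi x), f x < f z := by
  have h1 := (hasDerivAt_iff_tendsto_slope.1 hf).mono_left
    (nhdsWithin_mono x fun z (hz : x < z) => hz.ne')
  filter_upwards [h1.eventually (lt_mem_nhds h), self_mem_nhdsWithin] with z hz hxz
  have hxz' : 0 < z - x := sub_pos.2 hxz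
  rw [slope_def_field] at hz
  have := (div_pos_iff_of_pos_right hxz').1 hz
  linarith

theorem HasDerivAt.eventually_lt_left {f : ℝ → ℝ} {f' x : ℝ} (hf : HasDerivAt f f' x)
    (h : 0 < f') : ∀ᶠ z in nhdsWithin x (Iio x), f z < f x := by
  have h1 := (hasDerivAt_iff_tendsto_slope.1 hf).mono_left
    (nhdsWithin_mono x fun z (hz : z < x) => hz.ne)
  filter_upwards [h1.eventually (lt_mem_nhds h), self_mem_nhdsWithin] with z hz hxz
  have hxz' : 0 < x - z := sub_pos.2 hxz
  rw [slope_def_field, ← neg_sub x z, ← neg_sub (f x) (f z), neg_div_neg_eq] at hz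
  have := (div_pos_iff_of_pos_right hxz').1 hz
  linarith

section Bounds

variable {α m : ℝ} {v y h M : ℝ → ℝ}

theorem abs_deriv_le_of_one_lt (hα : 0 < α) (hv1 : v 1 = nonlinRoot α) (hy1 : y 1 = m)
    (hv : ∀ r, 0 < r → HasDerivAt v (y r) r) (hy : ∀ r, 0 < r → HasDerivAt y (h r) r) {R : ℝ}
    (heq : ∀ r ∈ Ioo 1 R, (1 - r ^ 2) * h r = nonlin α (v r)) : ∀ r ∈ Ioo 1 R, |y r| ≤ |m| := by
  set E : ℝ → ℝ := fun r => (r ^ 2 - 1) * y r ^ 2 / 2 + potential α (v r) with hE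
  have hE' : ∀ r, 0 < r →
      HasDerivAt E (r * y r ^ 2 + (r ^ 2 - 1) * y r * h r + nonlin α (v r) * y r) r := by
    intro r hr
    have h1 := (((((hasDerivAt_pow 2 r).sub_const 1).mul ((hy r hr).pow 2)).div_const 2).add
      ((hasDerivAt_potential hα (v r)).comp r (hv r hr)))
    refine h1.congr_deriv ?_
    simp
    ring
  have hE1 : E 1 = 0 := by simp [hE, hv1, potential_nonlinRoot hα]
  have hQ : ∀ r ∈ Ioo 1 R, HasDerivAt (fun r => E r / (r ^ 2 - 1))
      (-(2 * r * potential α (v r)) / (r ^ 2 - 1) ^ 2) r := by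
    intro r hr
    have h0 : r ^ 2 - 1 ≠ 0 := by nlinarith [hr.1]
    have h1 := (hE' r (by linarith [hr.1])).div ((hasDerivAt_pow 2 r).sub_const 1) h0
    refine h1.congr_deriv ?_
    rw [← heq r hr]
    simp only [hE]
    congr 1
    push_cast
    ring
  have hanti : AntitoneOn (fun r => E r / (r ^ 2 - 1)) (Ioo 1 R) := by
    refine antitoneOn_of_deriv_nonpos (convex_Ioo 1 R)
      (fun r hr => (hQ r hr).continuousAt.continuousWithinAt) (fun r hr => ?_) fun r hr => ?_
    · exact (hQ r (interior_subset hr)).differentiableAt.differentiableWithinAt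
    · have hr' := interior_subset hr
      rw [(hQ r hr').deriv]
      refine div_nonpos_of_nonpos_of_nonneg (neg_nonpos.2 ?_) (sq_nonneg _)
      have := potential_nonneg hα (v r)
      have : 0 < r := by linarith [hr'.1]
      positivity
  have hlim : Tendsto (fun r => E r / (r ^ 2 - 1)) (nhdsWithin 1 (Ioi 1)) (nhds (m ^ 2 / 2)) := by
    have h1 := hasDerivAt_iff_tendsto_slope.1 (hE' 1 one_pos)
    rw [hv1, hy1, nonlin_nonlinRoot hα] at h1
    have h2 : Tendsto (fun r : ℝ => r + 1) (nhdsWithin 1 {1}ᶜ) (nhds (1 + 1)) :=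
      ((continuous_id.add continuous_const).tendsto (1 : ℝ)).mono_left nhdsWithin_le_nhds
    have h3 := (h1.div h2 (by norm_num)).mono_left
      (nhdsWithin_mono (1 : ℝ) fun z (hz : 1 < z) => hz.ne')
    have h4 : (1 * m ^ 2 + (1 ^ 2 - 1) * m * h 1 + 0 * m) / (1 + 1) = m ^ 2 / 2 := by ring
    rw [h4] at h3
    refine h3.congr' ?_
    filter_upwards [self_mem_nhdsWithin] with r hr
    have hr' : (1 : ℝ) < r := hr
    simp only [Pi.div_apply]
    rw [slope_def_field, hE1, sub_zero, div_div]
    congr 1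
    ring
  intro r hr
  have h1 : E r / (r ^ 2 - 1) ≤ m ^ 2 / 2 := by
    refine ge_of_tendsto hlim ?_
    filter_upwards [Ioo_mem_nhdsGT hr.1] with s hs
    exact hanti ⟨hs.1, hs.2.trans hr.2⟩ hr hs.2.le
  have h2 : 0 < r ^ 2 - 1 := by nlinarith [hr.1]
  rw [div_le_iff₀ h2] at h1
  have h3 := potential_nonneg hα (v r)
  simp only [hE] at h1
  refine sq_le_sq.1 ?_
  have h4 : (r ^ 2 - 1) * (y r ^ 2) ≤ (r ^ 2 - 1) * m ^ 2 := by linarith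
  exact le_of_mul_le_mul_left h4 h2

theorem abs_lt_of_one_lt (hα : 0 < α) (hv1 : v 1 = nonlinRoot α) (hy1 : y 1 = m)
    (hv : ∀ r, 0 < r → HasDerivAt v (y r) r) (hy : ∀ r, 0 < r → HasDerivAt y (h r) r)
    (hM : ContinuousOn M (Ioi 0))
    (hMlt : ∀ r, 0 < r → nonlinRoot α + |m| * |r - 1| < M r)
    (heq : ∀ r, 0 < r → |v r| ≤ M r → (1 - r ^ 2) * h r = nonlin α (v r)) {r : ℝ} (hr : 1 < r) :
    |v r| < M r := by
  have hb := nonlinRoot_pos hα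
  have hvc : ContinuousOn v (Ioi 0) := fun r hr => (hv r hr).continuousAt.continuousWithinAt
  have key := forall_pos_of_step_right (f := fun r => M r - |v r|) (a := 1) (σ := r + 1)
    ((hM.sub hvc.abs).mono fun x hx => one_pos.trans hx.1) ?_ ?_ r ⟨hr, by linarith⟩
  · linarith
  · have h1 : ∀ᶠ s in nhds (1 : ℝ), |v s| < M s := by
      refine ((hv 1 one_pos).continuousAt.abs).eventually_lt
        (hM.continuousAt (Ioi_mem_nhds one_pos)) ?_
      rw [hv1, abs_of_pos hb]
      simpa using hMlt 1 one_pos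
    filter_upwards [nhdsWithin_le_nhds h1] with s hs
    linarith
  · intro x hx hx'
    have h1 := abs_deriv_le_of_one_lt hα hv1 hy1 hv hy (R := x) fun s hs =>
      heq s (by linarith [hs.1]) (by linarith [hx' s hs])
    have h2 := norm_image_sub_le_of_norm_deriv_le_segment' (f := v) (f' := y) (C := |m|)
      (a := 1) (b := x) (fun s hs => (hv s (by linarith [hs.1])).hasDerivWithinAt)
      (fun s hs => by
        rcases eq_or_lt_of_le hs.1 with h | h
        · rw [← h, hy1, Real.norm_eq_abs]
        · exact h1 s ⟨h, hs.2⟩) x (right_mem_Icc.2 hx.1.le)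
    have h3 := hMlt x (by linarith [hx.1])
    rw [hv1, Real.norm_eq_abs] at h2
    rw [abs_of_pos (by linarith [hx.1] : 0 < x - 1)] at h3
    have h4 := abs_sub_abs_le_abs_sub (v x) (nonlinRoot α)
    rw [abs_of_pos hb] at h4
    linarith

end Bounds

section LeftBounds

variable {α m : ℝ} {v y h M : ℝ → ℝ}

theorem hasDerivAt_rpow_mul {r β : ℝ} (hr : 0 < r) (hv : HasDerivAt v (y r) r) :
    HasDerivAt (fun s => s ^ β * v s) (r ^ (β - 1) * (β * v r + r * y r)) r := by
  refine ((Real.hasDerivAt_rpow_const (p := β) (Or.inl hr.ne')).mul hv).congr_deriv ?_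
  rw [Real.rpow_sub_one hr.ne']
  field_simp

theorem rpow_mul_lt_iff {r b x : ℝ} (hr : 0 < r) : r ^ α * x < b ↔ x < b * r ^ (-α) := by
  rw [Real.rpow_neg hr.le, ← div_eq_mul_inv, lt_div_iff₀ (by positivity), mul_comm]

theorem sq_mul_rpow_le {r x : ℝ} (hα : 0 < α) (hr : 0 < r) (hx : 0 < x) :
    r ^ 2 * x ^ (2 / α) = (r ^ α * x) ^ (2 / α) := by
  rw [Real.mul_rpow (by positivity) hx.le, ← Real.rpow_mul hr.le,
    show α * (2 / α) = (2 : ℕ) by push_cast; field_simp, Real.rpow_natCast]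

theorem bounds_step_of_neg (hα : 0 < α) (hv1 : v 1 = nonlinRoot α) (hy1 : y 1 = m) (hm : m < 0)
    (hmα : -(α * nonlinRoot α) < m)
    (hv : ∀ r, 0 < r → HasDerivAt v (y r) r) (hy : ∀ r, 0 < r → HasDerivAt y (h r) r) {r : ℝ}
    (hr0 : 0 < r) (hr1 : r < 1)
    (heq : ∀ s ∈ Ioo r 1, (1 - s ^ 2) * h s = nonlin α (v s))
    (hlow : ∀ s ∈ Ioo r 1, nonlinRoot α < v s)
    (hupp : ∀ s ∈ Ioo r 1, s ^ α * v s < nonlinRoot α) :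
    nonlinRoot α < v r ∧ r ^ α * v r < nonlinRoot α ∧ y r < 0 ∧ 0 < α * v r + r * y r := by
  have hb := nonlinRoot_pos hα
  have hpos : ∀ s ∈ Icc r 1, 0 < s := fun s hs => hr0.trans_le hs.1
  have hrI : r ∈ Icc r 1 := left_mem_Icc.2 hr1.le
  have h1I : (1 : ℝ) ∈ Icc r 1 := right_mem_Icc.2 hr1.le
  have hymono : MonotoneOn y (Icc r 1) :=
    monotoneOn_Icc_of_hasDerivAt (fun s hs => hy s (hpos s hs)) fun s hs => by
      have h1 : 0 < 1 - s ^ 2 := by nlinarith [hs.1, hs.2]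
      have h2 := nonlin_nonneg hα (hlow s hs).le
      rw [← heq s hs] at h2
      exact nonneg_of_mul_nonneg_right h2 h1
  have hyneg : ∀ s ∈ Icc r 1, y s ≤ m := fun s hs => hy1 ▸ hymono hs h1I hs.2
  have hvr : nonlinRoot α < v r := by
    have h1 : AntitoneOn (fun s => v s - m * s) (Icc r 1) :=
      antitoneOn_Icc_of_hasDerivAt
        (fun s hs => (hv s (hpos s hs)).sub ((hasDerivAt_id s).const_mul m))
        fun s hs => by
          have := hyneg s ⟨hs.1.le, hs.2.le⟩
          linarith
    have h2 := h1 hrI h1I hr1.le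
    simp only [hv1] at h2
    nlinarith
  have hP : AntitoneOn (fun s => s ^ (-α - 1) * (α * v s + s * y s)) (Icc r 1) := by
    refine antitoneOn_Icc_of_hasDerivAt
      (f' := fun s => s ^ (-α - 1 - 1) * (s ^ 2 * h s - α * (α + 1) * v s)) (fun s hs => ?_)
      fun s hs => ?_
    · have hs0 := hpos s hs
      have h1 := ((hv s hs0).const_mul α).add ((hasDerivAt_id s).mul (hy s hs0))
      refine (hasDerivAt_rpow_mul (y := fun _ => _) hs0 h1).congr_deriv ?_
      simp only [id, Pi.add_apply, Pi.mul_apply]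
      ring
    · have hs0 := hpos s ⟨hs.1.le, hs.2.le⟩
      have hvs : 0 < v s := hb.trans (hlow s hs)
      refine mul_nonpos_of_nonneg_of_nonpos (Real.rpow_nonneg hs0.le _) ?_
      have h1 : 0 < 1 - s ^ 2 := by nlinarith [hs.2]
      have h2 : s ^ 2 * v s ^ (2 / α) ≤ α * (α + 1) := by
        rw [sq_mul_rpow_le hα hs0 hvs, ← nonlinRoot_rpow hα]
        exact Real.rpow_le_rpow (by positivity) (hupp s hs).le (by positivity)
      have h3 := heq s hs
      rw [nonlin_of_pos hvs] at h3
      have h4 : (1 - s ^ 2) * (s ^ 2 * h s - α * (α + 1) * v s) =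
          v s * (s ^ 2 * v s ^ (2 / α) - α * (α + 1)) := by
        linear_combination s ^ 2 * h3
      have h5 : (1 - s ^ 2) * (s ^ 2 * h s - α * (α + 1) * v s) ≤ 0 := by
        rw [h4]
        exact mul_nonpos_of_nonneg_of_nonpos hvs.le (sub_nonpos.2 h2)
      exact nonpos_of_mul_nonpos_right h5 h1
  have hPpos : ∀ s ∈ Icc r 1, 0 < α * v s + s * y s := by
    intro s hs
    have h1 := hP hs h1I hs.2
    simp only [Real.one_rpow, hv1, hy1, one_mul] at h1
    exact pos_of_mul_pos_right (lt_of_lt_of_le (by linarith) h1)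
      (Real.rpow_nonneg (hpos s hs).le _)
  refine ⟨hvr, ?_, (hyneg r hrI).trans_lt hm, hPpos r hrI⟩
  have hu : StrictMonoOn (fun s => s ^ α * v s) (Icc r 1) := by
    have hd : ∀ s ∈ Icc r 1, HasDerivAt (fun s => s ^ α * v s)
        (s ^ (α - 1) * (α * v s + s * y s)) s := fun s hs =>
      hasDerivAt_rpow_mul (hpos s hs) (hv s (hpos s hs))
    refine strictMonoOn_of_deriv_pos (convex_Icc r 1)
      (fun s hs => (hd s hs).continuousAt.continuousWithinAt) fun s hs => ?_
    have hs' := interior_subset hs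
    rw [(hd s hs').deriv]
    exact mul_pos (Real.rpow_pos_of_pos (hpos s hs') _) (hPpos s hs')
  have := hu hrI h1I hr1
  simpa [hv1] using this

theorem bounds_of_neg (hα : 0 < α) (hv1 : v 1 = nonlinRoot α) (hy1 : y 1 = m) (hm : m < 0)
    (hmα : -(α * nonlinRoot α) < m)
    (hv : ∀ r, 0 < r → HasDerivAt v (y r) r) (hy : ∀ r, 0 < r → HasDerivAt y (h r) r)
    (hMlt : ∀ r, 0 < r → nonlinRoot α * r ^ (-α) < M r)
    (heq : ∀ r, 0 < r → |v r| ≤ M r → (1 - r ^ 2) * h r = nonlin α (v r)) {r : ℝ}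
    (hr0 : 0 < r) (hr1 : r < 1) :
    |v r| ≤ M r ∧
    nonlinRoot α < v r ∧ r ^ α * v r < nonlinRoot α ∧ y r < 0 ∧ 0 < α * v r + r * y r := by
  have hb := nonlinRoot_pos hα
  have habs : ∀ s, 0 < s → nonlinRoot α < v s → s ^ α * v s < nonlinRoot α → |v s| ≤ M s := by
    intro s hs h1 h2
    rw [abs_of_pos (hb.trans h1)]
    exact (((rpow_mul_lt_iff hs).1 h2).trans (hMlt s hs)).le
  have step : ∀ x ∈ Ioo (0 : ℝ) 1,
      (∀ s ∈ Ioo x 1, 0 < min (v s - nonlinRoot α) (nonlinRoot α - s ^ α * v s)) →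
      nonlinRoot α < v x ∧ x ^ α * v x < nonlinRoot α ∧ y x < 0 ∧ 0 < α * v x + x * y x := by
    intro x hx hx'
    have h1 : ∀ s ∈ Ioo x 1, nonlinRoot α < v s := fun s hs => by
      linarith [(lt_min_iff.1 (hx' s hs)).1]
    have h2 : ∀ s ∈ Ioo x 1, s ^ α * v s < nonlinRoot α := fun s hs => by
      linarith [(lt_min_iff.1 (hx' s hs)).2]
    exact bounds_step_of_neg hα hv1 hy1 hm hmα hv hy hx.1 hx.2
      (fun s hs => heq s (hx.1.trans hs.1)
        (habs s (hx.1.trans hs.1) (h1 s hs) (h2 s hs))) h1 h2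
  have hu : ∀ s, 0 < s → HasDerivAt (fun s => s ^ α * v s)
      (s ^ (α - 1) * (α * v s + s * y s)) s := fun s hs => hasDerivAt_rpow_mul hs (hv s hs)
  have hall := forall_pos_of_step_left
    (f := fun s => min (v s - nonlinRoot α) (nonlinRoot α - s ^ α * v s)) (a := 1) (τ := 0)
    (ContinuousOn.inf
      (fun s hs => ((hv s hs.1).continuousAt.sub continuousAt_const).continuousWithinAt)
      (fun s hs => (continuousAt_const.sub (hu s hs.1).continuousAt).continuousWithinAt))
    (by
      have h1 := (hv 1 one_pos).neg.eventually_lt_left (by rw [hy1]; linarith)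
      have h2 := (hu 1 one_pos).eventually_lt_left (by
        rw [Real.one_rpow, hv1, hy1]
        linarith)
      filter_upwards [h1, h2] with s hs1 hs2
      simp only [Pi.neg_apply, hv1, Real.one_rpow, one_mul] at hs1 hs2
      exact lt_min (by linarith) (by linarith))
    (fun x hx hx' => by
      obtain ⟨h1, h2, -⟩ := step x hx hx'
      exact lt_min (by linarith) (by linarith))
  have := step r ⟨hr0, hr1⟩ fun s hs => hall s ⟨hr0.trans hs.1, hs.2⟩
  exact ⟨habs r hr0 this.1 this.2.1, this⟩

theorem bounds_step_of_pos (hα : 0 < α) (hv1 : v 1 = nonlinRoot α) (hy1 : y 1 = m) (hm : 0 < m)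
    {K : ℝ} (hK : ∀ x, 0 < x → x < nonlinRoot α → -nonlin α x ≤ K * (nonlinRoot α - x))
    (hK0 : 0 ≤ K)
    (hv : ∀ r, 0 < r → HasDerivAt v (y r) r) (hy : ∀ r, 0 < r → HasDerivAt y (h r) r) {r : ℝ}
    (hr0 : 0 < r) (hr1 : r < 1)
    (heq : ∀ s ∈ Ioo r 1, (1 - s ^ 2) * h s = nonlin α (v s))
    (hlow : ∀ s ∈ Ioo r 1, 0 < v s) (hupp : ∀ s ∈ Ioo r 1, v s < nonlinRoot α) :
    nonlinRoot α - m * Real.exp K ≤ v r ∧ v r < nonlinRoot α ∧ 0 < y r := by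
  have hpos : ∀ s ∈ Icc r 1, 0 < s := fun s hs => hr0.trans_le hs.1
  have hrI : r ∈ Icc r 1 := left_mem_Icc.2 hr1.le
  have h1I : (1 : ℝ) ∈ Icc r 1 := right_mem_Icc.2 hr1.le
  have hyanti : AntitoneOn y (Icc r 1) :=
    antitoneOn_Icc_of_hasDerivAt (fun s hs => hy s (hpos s hs)) fun s hs => by
      have h1 : 0 < 1 - s ^ 2 := by nlinarith [hs.1, hs.2]
      have h2 := nonlin_nonpos hα (hlow s hs) (hupp s hs).le
      rw [← heq s hs] at h2
      exact nonpos_of_mul_nonpos_right h2 h1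
  have hym : ∀ s ∈ Icc r 1, m ≤ y s := fun s hs => hy1 ▸ hyanti hs h1I hs.2
  have hdiff : ∀ s ∈ Icc r 1, nonlinRoot α - v s ≤ y s * (1 - s) := by
    intro s hs
    have h1 : AntitoneOn (fun t => v t - y s * t) (Icc s 1) :=
      antitoneOn_Icc_of_hasDerivAt
        (fun t ht => (hv t (hpos t ⟨hs.1.trans ht.1, ht.2⟩)).sub
          ((hasDerivAt_id t).const_mul (y s)))
        fun t ht => by
          have := hyanti hs ⟨hs.1.trans ht.1.le, ht.2.le⟩ ht.1.le
          linarith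
    have h2 := h1 (left_mem_Icc.2 hs.2) (right_mem_Icc.2 hs.2) hs.2
    simp only [hv1] at h2
    linarith
  have hexp : MonotoneOn (fun s => y s * Real.exp (K * s)) (Icc r 1) := by
    refine monotoneOn_Icc_of_hasDerivAt
      (fun s hs => (hy s (hpos s hs)).mul ((hasDerivAt_id s).const_mul K).exp) fun s hs => ?_
    have hs' : s ∈ Icc r 1 := ⟨hs.1.le, hs.2.le⟩
    have hs0 := hpos s hs'
    have h1 : 0 < 1 - s := by linarith [hs.2]
    have h2 := hK _ (hlow s hs) (hupp s hs)
    rw [← heq s hs] at h2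
    have h3 := mul_le_mul_of_nonneg_left (hdiff s hs') hK0
    have h4 : (1 - s) * -((1 + s) * h s) ≤ (1 - s) * (K * y s) := by linarith
    have h5 := le_of_mul_le_mul_left h4 h1
    have h6 : 0 ≤ K * y s := mul_nonneg hK0 (hm.le.trans (hym s hs'))
    have h7 : 0 ≤ h s + K * y s := by
      by_contra! hneg
      nlinarith
    have h8 := mul_nonneg h7 (Real.exp_pos (K * s)).le
    simp only [id]
    linarith
  have hyr : y r ≤ m * Real.exp K := by
    have h1 := hexp hrI h1I hr1.le
    simp only [hy1, mul_one] at h1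
    have h2 : 1 ≤ Real.exp (K * r) := Real.one_le_exp (by positivity)
    have h3 := hym r hrI
    nlinarith
  have h0 := hym r hrI
  refine ⟨?_, ?_, hm.trans_le h0⟩
  · have := hdiff r hrI
    nlinarith
  · have h1 : StrictMonoOn v (Icc r 1) := by
      refine strictMonoOn_of_deriv_pos (convex_Icc r 1)
        (fun s hs => (hv s (hpos s hs)).continuousAt.continuousWithinAt) fun s hs => ?_
      have hs' := interior_subset hs
      rw [(hv s (hpos s hs')).deriv]
      exact hm.trans_le (hym s hs')
    exact hv1 ▸ h1 hrI h1I hr1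

theorem bounds_of_pos (hα : 0 < α) (hv1 : v 1 = nonlinRoot α) (hy1 : y 1 = m) (hm : 0 < m)
    {K : ℝ} (hK : ∀ x, 0 < x → x < nonlinRoot α → -nonlin α x ≤ K * (nonlinRoot α - x))
    (hK0 : 0 ≤ K) (hmK : m * Real.exp K < nonlinRoot α)
    (hv : ∀ r, 0 < r → HasDerivAt v (y r) r) (hy : ∀ r, 0 < r → HasDerivAt y (h r) r)
    (hMlt : ∀ r, 0 < r → nonlinRoot α < M r)
    (heq : ∀ r, 0 < r → |v r| ≤ M r → (1 - r ^ 2) * h r = nonlin α (v r)) {r : ℝ}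
    (hr0 : 0 < r) (hr1 : r < 1) :
    |v r| ≤ M r ∧ nonlinRoot α - m * Real.exp K ≤ v r ∧ v r < nonlinRoot α ∧ 0 < y r := by
  have habs : ∀ s, 0 < s → 0 < v s → v s < nonlinRoot α → |v s| ≤ M s := by
    intro s hs h1 h2
    rw [abs_of_pos h1]
    exact (h2.trans (hMlt s hs)).le
  have step : ∀ x ∈ Ioo (0 : ℝ) 1,
      (∀ s ∈ Ioo x 1, 0 < min (v s) (nonlinRoot α - v s)) →
      nonlinRoot α - m * Real.exp K ≤ v x ∧ v x < nonlinRoot α ∧ 0 < y x := by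
    intro x hx hx'
    have h1 : ∀ s ∈ Ioo x 1, 0 < v s := fun s hs => (lt_min_iff.1 (hx' s hs)).1
    have h2 : ∀ s ∈ Ioo x 1, v s < nonlinRoot α := fun s hs => by
      linarith [(lt_min_iff.1 (hx' s hs)).2]
    exact bounds_step_of_pos hα hv1 hy1 hm hK hK0 hv hy hx.1 hx.2
      (fun s hs => heq s (hx.1.trans hs.1)
        (habs s (hx.1.trans hs.1) (h1 s hs) (h2 s hs))) h1 h2
  have hall := forall_pos_of_step_left
    (f := fun s => min (v s) (nonlinRoot α - v s)) (a := 1) (τ := 0)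
    (ContinuousOn.inf (fun s hs => (hv s hs.1).continuousAt.continuousWithinAt)
      (fun s hs => (continuousAt_const.sub (hv s hs.1).continuousAt).continuousWithinAt))
    (by
      have h1 := (hv 1 one_pos).eventually_lt_left (by rw [hy1]; exact hm)
      have h2 : ∀ᶠ s in nhds (1 : ℝ), 0 < v s :=
        (hv 1 one_pos).continuousAt.eventually (lt_mem_nhds (hv1 ▸ nonlinRoot_pos hα))
      filter_upwards [h1, nhdsWithin_le_nhds h2] with s hs1 hs2
      rw [hv1] at hs1
      exact lt_min hs2 (by linarith))
    (fun x hx hx' => by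
      obtain ⟨h1, h2, -⟩ := step x hx hx'
      exact lt_min (by linarith) (by linarith))
  have := step r ⟨hr0, hr1⟩ fun s hs => hall s ⟨hr0.trans hs.1, hs.2⟩
  exact ⟨habs r hr0 (by linarith [this.1]) this.2.1, this⟩

end LeftBounds

section Asymptotics

variable {α : ℝ} {v y h : ℝ → ℝ}

/-- Wronskian comparison of `v'' = h` with a supersolution `ζ ≥ 1` near the origin. -/
theorem exists_le_mul_of_supersolution {ζ ζ' ζ'' : ℝ → ℝ} {r₁ : ℝ}
    (hv : ∀ r, 0 < r → HasDerivAt v (y r) r) (hy : ∀ r, 0 < r → HasDerivAt y (h r) r)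
    (hζ : ∀ r, 0 < r → HasDerivAt ζ (ζ' r) r) (hζ' : ∀ r, 0 < r → HasDerivAt ζ' (ζ'' r) r)
    (hone : ∀ r ∈ Ioc 0 r₁, 1 ≤ ζ r) (hle : ∀ r ∈ Ioc 0 r₁, h r * ζ r ≤ v r * ζ'' r) :
    ∃ C, ∀ r ∈ Ioc 0 r₁, v r ≤ C * ζ r := by
  set W : ℝ → ℝ := fun s => y s * ζ s - v s * ζ' s with hW
  refine ⟨v r₁ / ζ r₁ + |W r₁| * r₁, fun r hr => ?_⟩
  have hpos : ∀ s ∈ Icc r r₁, 0 < s := fun s hs => hr.1.trans_le hs.1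
  have hrI : r ∈ Icc r r₁ := left_mem_Icc.2 hr.2
  have h1I : r₁ ∈ Icc r r₁ := right_mem_Icc.2 hr.2
  have h1 : AntitoneOn W (Icc r r₁) :=
    antitoneOn_Icc_of_hasDerivAt (f' := fun s => h s * ζ s - v s * ζ'' s)
      (fun s hs => by
        have hs0 := hpos s hs
        refine (((hy s hs0).mul (hζ s hs0)).sub ((hv s hs0).mul (hζ' s hs0))).congr_deriv ?_
        ring)
      fun s hs => sub_nonpos.2 (hle s ⟨hr.1.trans hs.1, hs.2.le⟩)
  have h2 : MonotoneOn (fun s => v s / ζ s + |W r₁| * s) (Icc r r₁) := by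
    refine monotoneOn_Icc_of_hasDerivAt (f' := fun s => W s / ζ s ^ 2 + |W r₁| * 1)
      (fun s hs => ?_) fun s hs => ?_
    · have hs0 := hpos s hs
      have hz : ζ s ≠ 0 := (one_pos.trans_le (hone s ⟨hs0, hs.2⟩)).ne'
      exact ((hv s hs0).div (hζ s hs0) hz).add ((hasDerivAt_id s).const_mul _)
    · have hs' : s ∈ Icc r r₁ := ⟨hs.1.le, hs.2.le⟩
      have hz := hone s ⟨hpos s hs', hs.2.le⟩
      have hz2 : 1 ≤ ζ s ^ 2 := one_le_pow₀ hz
      have hW1 := h1 hs' h1I hs.2.le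
      have hW2 := neg_abs_le (W r₁)
      have h3 : -|W r₁| ≤ W s / ζ s ^ 2 := by
        rw [le_div_iff₀ (by linarith)]
        nlinarith [abs_nonneg (W r₁)]
      linarith
  have h3 := h2 hrI h1I hr.2
  simp only at h3
  have hz := one_pos.trans_le (hone r hr)
  rw [← div_le_iff₀ hz]
  have := mul_nonneg (abs_nonneg (W r₁)) hr.1.le
  linarith

theorem exists_forall_le_near_zero (hα : 0 < α)
    (hv : ∀ r, 0 < r → HasDerivAt v (y r) r) (hy : ∀ r, 0 < r → HasDerivAt y (h r) r)
    (heq : ∀ r ∈ Ioo (0 : ℝ) 1, (1 - r ^ 2) * h r = nonlin α (v r))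
    (hlow : ∀ r ∈ Ioo (0 : ℝ) 1, 0 < v r)
    (hupp : ∀ r ∈ Ioo (0 : ℝ) 1, r ^ α * v r < nonlinRoot α)
    (hmono : ∀ r ∈ Ioo (0 : ℝ) 1, 0 < α * v r + r * y r) :
    ∃ r₂ C, 0 < r₂ ∧ r₂ ≤ 1 / 2 ∧ ∀ r ∈ Ioc 0 r₂, v r ≤ C := by
  have he : 0 < 2 / α := by positivity
  have hI : ∀ r ∈ Ioc (0 : ℝ) (1 / 2), r ∈ Ioo (0 : ℝ) 1 := fun r hr =>
    ⟨hr.1, by linarith [hr.2]⟩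
  have hhalf : (1 / 2 : ℝ) ∈ Ioo (0 : ℝ) 1 := by norm_num
  have hr2h : ∀ r ∈ Ioo (0 : ℝ) 1, (1 - r ^ 2) * (r ^ 2 * h r) =
      v r * (r ^ 2 * v r ^ (2 / α) - α * (α + 1) * r ^ 2) := by
    intro r hr
    have h1 := heq r hr
    rw [nonlin_of_pos (hlow r hr)] at h1
    linear_combination r ^ 2 * h1
  obtain ⟨β, hβ0, hβα, C, hC⟩ : ∃ β, 0 < β ∧ β < α ∧
      ∃ C, ∀ r ∈ Ioc (0 : ℝ) (1 / 2), v r ≤ C * r ^ (-β) := by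
    set q := ((1 / 2 : ℝ) ^ α * v (1 / 2)) ^ (2 / α) with hq
    have hq0 : 0 ≤ (1 / 2 : ℝ) ^ α * v (1 / 2) :=
      mul_nonneg (by positivity) (hlow _ hhalf).le
    have hqc : q < α * (α + 1) := by
      rw [← nonlinRoot_rpow hα]
      exact Real.rpow_lt_rpow hq0 (hupp _ hhalf) he
    have hqle : ∀ r ∈ Ioc (0 : ℝ) (1 / 2), r ^ 2 * v r ^ (2 / α) ≤ q := by
      intro r hr
      rw [sq_mul_rpow_le hα hr.1 (hlow r (hI r hr))]
      refine Real.rpow_le_rpow (mul_nonneg (Real.rpow_nonneg hr.1.le _)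
        (hlow r (hI r hr)).le) ?_ he.le
      have hm : MonotoneOn (fun s => s ^ α * v s) (Icc r (1 / 2)) :=
        monotoneOn_Icc_of_hasDerivAt
          (fun s hs => hasDerivAt_rpow_mul (hr.1.trans_le hs.1) (hv s (hr.1.trans_le hs.1)))
          fun s hs => mul_nonneg (Real.rpow_nonneg (hr.1.trans hs.1).le _)
            (hmono s ⟨hr.1.trans hs.1, by linarith [hs.2]⟩).le
      exact hm (left_mem_Icc.2 hr.2) (right_mem_Icc.2 hr.2) hr.2
    set δ := min (α / 2) ((α * (α + 1) - q) / (2 * α + 1)) with hδ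
    have hδ0 : 0 < δ := lt_min (by positivity) (div_pos (by linarith) (by positivity))
    have hδ1 : δ ≤ α / 2 := min_le_left _ _
    have hδ2 : δ * (2 * α + 1) ≤ α * (α + 1) - q :=
      (le_div_iff₀ (by positivity)).1 (min_le_right _ _)
    refine ⟨α - δ, by linarith, by linarith, ?_⟩
    set β := α - δ with hβ
    have hββ : q ≤ β * (β + 1) := by
      rw [hβ]
      nlinarith [sq_nonneg δ]
    refine exists_le_mul_of_supersolution (ζ := fun r => r ^ (-β))
      (ζ' := fun r => -β * r ^ (-β - 1)) (ζ'' := fun r => -β * ((-β - 1) * r ^ (-β - 1 - 1)))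
      hv hy (fun r hr => Real.hasDerivAt_rpow_const (Or.inl hr.ne'))
      (fun r hr => (Real.hasDerivAt_rpow_const (Or.inl hr.ne')).const_mul _)
      (fun r hr => Real.one_le_rpow_of_pos_of_le_one_of_nonpos hr.1 (by linarith [hr.2])
        (by linarith)) fun r hr => ?_
    have hr0 := hr.1
    have h1 : 0 < 1 - r ^ 2 := by nlinarith [hr.2]
    have hvr := hlow r (hI r hr)
    have h2 : r ^ 2 * h r ≤ v r * q := by
      refine le_of_mul_le_mul_left ?_ h1
      rw [hr2h r (hI r hr)]
      have h3 : r ^ 2 * v r ^ (2 / α) - α * (α + 1) * r ^ 2 ≤ q * (1 - r ^ 2) := by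
        nlinarith [hqle r hr, sq_nonneg r]
      nlinarith
    have h4 : r ^ (-β) = r ^ 2 * r ^ (-β - 1 - 1) := by
      rw [← Real.rpow_natCast, ← Real.rpow_add hr0]
      congr 1
      push_cast
      ring
    rw [h4]
    have h5 : 0 ≤ r ^ (-β - 1 - 1) := Real.rpow_nonneg hr0.le _
    have h6 : r ^ 2 * h r ≤ v r * (β * (β + 1)) :=
      h2.trans (mul_le_mul_of_nonneg_left hββ hvr.le)
    have h7 := mul_le_mul_of_nonneg_right h6 h5
    linarith
  have hC0 : 0 < C := by
    have h1 := (hlow _ hhalf).trans_le (hC (1 / 2) (by norm_num))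
    exact pos_of_mul_pos_left h1 (by positivity)
  set κ := 2 - β * (2 / α) with hκ
  have hκ0 : 0 < κ := by
    have : β * (2 / α) < α * (2 / α) := mul_lt_mul_of_pos_right hβα he
    have h2 : α * (2 / α) = 2 := by field_simp
    linarith
  set k := min κ 1 / 2 with hk
  have hk0 : 0 < k := half_pos (lt_min hκ0 one_pos)
  have hkκ : k ≤ κ / 2 := by linarith [min_le_left κ 1]
  have hk1 : k ≤ 1 / 2 := by linarith [min_le_right κ 1]
  set A := C ^ (2 / α) with hA
  have hA0 : 0 < A := Real.rpow_pos_of_pos hC0 _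
  set D := k * (1 - k) / (4 * A) with hD
  have hD0 : 0 < D := div_pos (mul_pos hk0 (by linarith)) (by positivity)
  set r₂ := min (1 / 2) (D ^ (1 / k)) with hr₂
  have hr₂0 : 0 < r₂ := lt_min (by norm_num) (Real.rpow_pos_of_pos hD0 _)
  have hr₂h : r₂ ≤ 1 / 2 := min_le_left _ _
  have hI₂ : ∀ r ∈ Ioc 0 r₂, r ∈ Ioc (0 : ℝ) (1 / 2) := fun r hr => ⟨hr.1, hr.2.trans hr₂h⟩
  obtain ⟨C', hC'⟩ := exists_le_mul_of_supersolution (ζ := fun r => 2 - r ^ k)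
    (ζ' := fun r => -(k * r ^ (k - 1))) (ζ'' := fun r => -(k * ((k - 1) * r ^ (k - 1 - 1))))
    hv hy (fun r hr => (Real.hasDerivAt_rpow_const (Or.inl hr.ne')).const_sub 2)
    (fun r hr => ((Real.hasDerivAt_rpow_const (Or.inl hr.ne')).const_mul _).neg)
    (fun r hr => by
      have := Real.rpow_le_one hr.1.le (by linarith [hr.2]) hk0.le
      linarith)
    (fun r hr => by
      have hr0 := hr.1
      have hr' := hI₂ r hr
      have hvr := hlow r (hI r hr')
      have h1 : 3 / 4 ≤ 1 - r ^ 2 := by nlinarith [hr'.2]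
      have hrk0 : 0 < r ^ k := Real.rpow_pos_of_pos hr0 _
      have hrk1 : r ^ k ≤ 1 := Real.rpow_le_one hr0.le (by linarith [hr'.2]) hk0.le
      have hrkD : r ^ k ≤ D := by
        have h2 := Real.rpow_le_rpow hr0.le (hr.2.trans (min_le_right _ _)) hk0.le
        rwa [← Real.rpow_mul hD0.le, one_div_mul_cancel hk0.ne', Real.rpow_one] at h2
      have h3 : r ^ 2 * v r ^ (2 / α) ≤ A * r ^ κ := by
        have h4 : v r ^ (2 / α) ≤ (C * r ^ (-β)) ^ (2 / α) :=
          Real.rpow_le_rpow hvr.le (hC r hr') he.le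
        rw [Real.mul_rpow hC0.le (by positivity), ← Real.rpow_mul hr0.le] at h4
        have h5 : r ^ κ = r ^ 2 * r ^ (-β * (2 / α)) := by
          rw [← Real.rpow_natCast, ← Real.rpow_add hr0]
          congr 1
          push_cast
          ring
        rw [h5]
        have := mul_le_mul_of_nonneg_left h4 (sq_nonneg r)
        linarith
      have h6 : r ^ κ ≤ r ^ k * r ^ k := by
        rw [← Real.rpow_add hr0]
        exact Real.rpow_le_rpow_of_exponent_ge hr0 (by linarith [hr'.2]) (by linarith)
      have h7 : r ^ 2 * v r ^ (2 / α) ≤ A * D * r ^ k := by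
        have h8 : r ^ κ ≤ D * r ^ k := h6.trans (mul_le_mul_of_nonneg_right hrkD hrk0.le)
        calc _ ≤ A * r ^ κ := h3
          _ ≤ A * (D * r ^ k) := mul_le_mul_of_nonneg_left h8 hA0.le
          _ = _ := by ring
      have h9 : A * D = k * (1 - k) / 4 := by
        rw [hD]
        field_simp
      rw [h9] at h7
      have h10 : r ^ 2 * h r ≤ v r * (k * (1 - k) / 2 * r ^ k) := by
        refine le_of_mul_le_mul_left ?_ (by linarith : 0 < 1 - r ^ 2)
        rw [hr2h r (hI r hr')]
        have h11 : 0 ≤ k * (1 - k) * r ^ k :=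
          mul_nonneg (mul_nonneg hk0.le (by linarith)) hrk0.le
        have h12 : 0 ≤ α * (α + 1) * r ^ 2 := by positivity
        have h13 : r ^ 2 * v r ^ (2 / α) - α * (α + 1) * r ^ 2 ≤
            (1 - r ^ 2) * (k * (1 - k) / 2 * r ^ k) := by nlinarith
        have := mul_le_mul_of_nonneg_left h13 hvr.le
        linarith
      have h14 : r ^ k = r ^ 2 * r ^ (k - 1 - 1) := by
        rw [← Real.rpow_natCast, ← Real.rpow_add hr0]
        congr 1
        push_cast
        ring
      have h15 : 0 ≤ v r * (k * (1 - k) / 2 * r ^ k) := by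
        have : 0 ≤ 1 - k := by linarith
        positivity
      have h16 : r ^ 2 * (h r * (2 - r ^ k)) ≤
          r ^ 2 * (v r * -(k * ((k - 1) * r ^ (k - 1 - 1)))) := by
        have h17 : r ^ 2 * (v r * -(k * ((k - 1) * r ^ (k - 1 - 1)))) =
            2 * (v r * (k * (1 - k) / 2 * r ^ k)) := by
          rw [h14]
          ring
        rw [h17]
        have h18 : r ^ 2 * (h r * (2 - r ^ k)) = (r ^ 2 * h r) * (2 - r ^ k) := by ring
        rw [h18]
        have h19 := mul_le_mul_of_nonneg_right h10 (by linarith : 0 ≤ 2 - r ^ k)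
        nlinarith
      exact le_of_mul_le_mul_left h16 (by positivity))
  refine ⟨r₂, C' * 2, hr₂0, hr₂h, fun r hr => (hC' r hr).trans ?_⟩
  have hrk0 : 0 < r ^ k := Real.rpow_pos_of_pos hr.1 _
  have hrk1 : r ^ k ≤ 1 := Real.rpow_le_one hr.1.le (by linarith [hr.2]) hk0.le
  have hC'0 : 0 < C' := by
    refine pos_of_mul_pos_left ((hlow r (hI r (hI₂ r hr))).trans_le (hC' r hr)) ?_
    linarith
  exact mul_le_mul_of_nonneg_left (by linarith) hC'0.le

theorem exists_tendsto_nhdsGT_zero (hα : 0 < α)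
    (hv : ∀ r, 0 < r → HasDerivAt v (y r) r) (hy : ∀ r, 0 < r → HasDerivAt y (h r) r)
    (heq : ∀ r ∈ Ioo (0 : ℝ) 1, (1 - r ^ 2) * h r = nonlin α (v r)) {r₂ b C : ℝ}
    (hr₂ : 0 < r₂) (hr₂h : r₂ ≤ 1 / 2) (hb : 0 < b) (hlow : ∀ r ∈ Ioc 0 r₂, b ≤ v r)
    (hupp : ∀ r ∈ Ioc 0 r₂, v r ≤ C) :
    ∃ L > 0, Tendsto v (nhdsWithin 0 (Ioi 0)) (nhds L) ∧
      Tendsto (fun r => r * y r) (nhdsWithin 0 (Ioi 0)) (nhds 0) := by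
  have hC0 : 0 < C := hb.trans_le ((hlow r₂ ⟨hr₂, le_rfl⟩).trans (hupp r₂ ⟨hr₂, le_rfl⟩))
  set K := (2 / α + 1) * |C| ^ (2 / α) + α * (α + 1) with hK
  have hK0 : 0 ≤ K := by positivity
  have hh : ∀ r ∈ Ioc 0 r₂, |h r| ≤ 2 * (K * C) := by
    intro r hr
    have hvr := hb.trans_le (hlow r hr)
    have h1 := abs_nonlin_sub_le hα (M := C) (x := v r) (y := 0)
      (by rw [abs_of_pos hvr]; exact hupp r hr) (by rw [abs_zero]; exact hC0.le)
    have h2 : nonlin α 0 = 0 := by simp [nonlin]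
    rw [h2, sub_zero, sub_zero, abs_of_pos hvr, ← heq r ⟨hr.1, by linarith [hr.2]⟩, abs_mul] at h1
    have h3 : 3 / 4 ≤ 1 - r ^ 2 := by nlinarith [hr.1, hr.2]
    rw [abs_of_pos (by linarith)] at h1
    have h4 := mul_le_mul_of_nonneg_left (hupp r hr) hK0
    have h5 := mul_le_mul_of_nonneg_right h3 (abs_nonneg (h r))
    have h6 : 0 ≤ K * C := mul_nonneg hK0 hC0.le
    linarith
  set D := 2 * (K * C) * r₂ + |y r₂| with hD
  have hyb : ∀ r ∈ Ioc 0 r₂, |y r| ≤ D := by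
    intro r hr
    have h1 := (convex_Icc r r₂).norm_image_sub_le_of_norm_hasDerivWithin_le (f := y) (f' := h)
      (fun s hs => (hy s (hr.1.trans_le hs.1)).hasDerivWithinAt)
      (fun s hs => hh s ⟨hr.1.trans_le hs.1, hs.2⟩) (right_mem_Icc.2 hr.2) (left_mem_Icc.2 hr.2)
    rw [Real.norm_eq_abs, Real.norm_eq_abs, abs_sub_comm r, abs_of_nonneg (sub_nonneg.2 hr.2)] at h1
    have h2 := abs_sub_abs_le_abs_sub (y r) (y r₂)
    have h3 : 2 * (K * C) * (r₂ - r) ≤ 2 * (K * C) * r₂ :=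
      mul_le_mul_of_nonneg_left (by linarith [hr.1]) (by positivity)
    linarith
  have hD0 : 0 ≤ D := by positivity
  have hmem : ∀ᶠ r in nhdsWithin (0 : ℝ) (Ioi 0), r ∈ Ioc 0 r₂ := Ioc_mem_nhdsGT hr₂
  have hlip : LipschitzOnWith D.toNNReal v (Ioc 0 r₂) :=
    (convex_Ioc 0 r₂).lipschitzOnWith_of_nnnorm_hasDerivWithin_le
      (fun s hs => (hv s hs.1).hasDerivWithinAt) fun s hs => by
        rw [← NNReal.coe_le_coe, coe_nnnorm, Real.coe_toNNReal D hD0]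
        exact hyb s hs
  obtain ⟨g, hg, hgv⟩ := hlip.extend_real
  have hlim : Tendsto v (nhdsWithin 0 (Ioi 0)) (nhds (g 0)) := by
    refine ((hg.continuous.tendsto 0).mono_left nhdsWithin_le_nhds).congr' ?_
    filter_upwards [hmem] with r hr using (hgv hr).symm
  refine ⟨g 0, hb.trans_le (ge_of_tendsto hlim ?_), hlim, ?_⟩
  · filter_upwards [hmem] with r hr using hlow r hr
  · have h0 : Tendsto (fun r : ℝ => r * D) (nhdsWithin 0 (Ioi 0)) (nhds 0) := by
      have : Tendsto (fun r : ℝ => r * D) (nhds 0) (nhds (0 * D)) :=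
        (continuous_id.mul continuous_const).tendsto 0
      rw [zero_mul] at this
      exact this.mono_left nhdsWithin_le_nhds
    refine squeeze_zero_norm' ?_ h0
    filter_upwards [hmem] with r hr
    rw [norm_mul, Real.norm_of_nonneg hr.1.le]
    exact mul_le_mul_of_nonneg_left (hyb r hr) hr.1.le

end Asymptotics

theorem contDiffOn_two_of_hasDerivAt {f f' f'' : ℝ → ℝ} {s : Set ℝ} (hs : IsOpen s)
    (hf : ∀ x ∈ s, HasDerivAt f (f' x) x) (hf' : ∀ x ∈ s, HasDerivAt f' (f'' x) x)
    (hc : ContinuousOn f'' s) : ContDiffOn ℝ 2 f s := by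
  have h1 : ContDiffOn ℝ 1 f' s := by
    rw [show (1 : WithTop ℕ∞) = 0 + 1 from rfl, contDiffOn_succ_iff_deriv_of_isOpen hs]
    refine ⟨fun x hx => (hf' x hx).differentiableAt.differentiableWithinAt, by simp, ?_⟩
    rw [contDiffOn_zero]
    exact hc.congr fun x hx => (hf' x hx).deriv
  rw [show (2 : WithTop ℕ∞) = 1 + 1 from rfl, contDiffOn_succ_iff_deriv_of_isOpen hs]
  exact ⟨fun x hx => (hf x hx).differentiableAt.differentiableWithinAt, by simp,
    h1.congr fun x hx => (hf x hx).deriv⟩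

/-- A Lipschitz constant of `nonlin α` on `[-nonlinRoot α, nonlinRoot α]`. -/
noncomputable def nonlinLip (α : ℝ) : ℝ :=
  (2 / α + 1) * |nonlinRoot α| ^ (2 / α) + α * (α + 1)

theorem exists_profile {α m : ℝ} (hα : 0 < α) (hmα : -(α * nonlinRoot α) < m)
    (hmK : m * Real.exp (nonlinLip α) < nonlinRoot α) :
    ∃ v y h : ℝ → ℝ, v 1 = nonlinRoot α ∧ y 1 = m ∧
      (∀ r, 0 < r → HasDerivAt v (y r) r) ∧ (∀ r, 0 < r → HasDerivAt y (h r) r) ∧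
      ContinuousOn h (Ioi 0) ∧ (∀ r, 0 < r → (1 - r ^ 2) * h r = nonlin α (v r)) ∧
      (∀ r ∈ Ioo (0 : ℝ) 1, 0 < v r ∧ r ^ α * v r < nonlinRoot α ∧ 0 < α * v r + r * y r) ∧
      ∃ L > 0, Tendsto v (nhdsWithin 0 (Ioi 0)) (nhds L) ∧
        Tendsto (fun r => r * y r) (nhdsWithin 0 (Ioi 0)) (nhds 0) := by
  have hb := nonlinRoot_pos hα
  have hrα : ∀ r ∈ Ioo (0 : ℝ) 1, r ^ α < 1 := fun r hr =>
    Real.rpow_lt_one hr.1.le hr.2 hα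
  rcases eq_or_ne m 0 with rfl | hm
  · refine ⟨fun _ => nonlinRoot α, fun _ => 0, fun _ => 0, rfl, rfl,
      fun r _ => hasDerivAt_const _ _,
      fun r _ => hasDerivAt_const _ _, continuousOn_const, fun r _ => ?_, fun r hr => ⟨hb, ?_, ?_⟩,
      nonlinRoot α, hb, tendsto_const_nhds, by simp⟩
    · rw [mul_zero, nonlin_nonlinRoot hα]
    · nlinarith [hrα r hr]
    · rw [mul_zero, add_zero]
      positivity
  set M : ℝ → ℝ := fun r => nonlinRoot α * r ^ (-α) + nonlinRoot α + 1 + |m| * |r - 1| with hM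
  have hMc : ContinuousOn M (Ioi 0) := by
    have h1 : ContinuousOn (fun r : ℝ => r ^ (-α)) (Ioi 0) := fun r hr =>
      (Real.continuousAt_rpow_const r _ (Or.inl (ne_of_gt hr))).continuousWithinAt
    exact (((continuousOn_const.mul h1).add continuousOn_const).add continuousOn_const).add
      (by fun_prop)
  have hrp : ∀ r : ℝ, 0 < r → 0 < nonlinRoot α * r ^ (-α) := fun r hr =>
    mul_pos hb (Real.rpow_pos_of_pos hr _)
  have habs : ∀ r : ℝ, 0 ≤ |m| * |r - 1| := fun r => by positivity
  have hM1 : ∀ r, 0 < r → nonlinRoot α * r ^ (-α) < M r := fun r _ => by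
    simp only [hM]
    linarith [habs r]
  have hM2 : ∀ r, 0 < r → nonlinRoot α < M r := fun r hr => by
    simp only [hM]
    linarith [habs r, hrp r hr]
  have hM3 : ∀ r, 0 < r → nonlinRoot α + |m| * |r - 1| < M r := fun r hr => by
    simp only [hM]
    linarith [hrp r hr]
  obtain ⟨v, y, h, hv1, hy1, hv, hy, hh, heq⟩ := exists_truncated_solution hα m hMc hM2
  have key : (∀ r ∈ Ioo (0 : ℝ) 1, |v r| ≤ M r) →
      ∀ r, 0 < r → (1 - r ^ 2) * h r = nonlin α (v r) := by
    intro h0 r hr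
    refine heq r hr ?_
    rcases lt_trichotomy r 1 with h1 | rfl | h1
    · exact h0 r ⟨hr, h1⟩
    · rw [hv1, abs_of_pos hb]
      exact (hM2 1 one_pos).le
    · exact (abs_lt_of_one_lt hα hv1 hy1 hv hy hMc hM3 heq h1).le
  rcases hm.lt_or_gt with hm | hm
  · have hB := fun r (hr : r ∈ Ioo (0 : ℝ) 1) =>
      bounds_of_neg hα hv1 hy1 hm hmα hv hy hM1 heq hr.1 hr.2
    have heq' := key fun r hr => (hB r hr).1
    have hP : ∀ r ∈ Ioo (0 : ℝ) 1,
        0 < v r ∧ r ^ α * v r < nonlinRoot α ∧ 0 < α * v r + r * y r := fun r hr =>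
      ⟨hb.trans (hB r hr).2.1, (hB r hr).2.2.1, (hB r hr).2.2.2.2⟩
    obtain ⟨r₂, C, hr₂, hr₂h, hC⟩ := exists_forall_le_near_zero hα hv hy
      (fun r hr => heq' r hr.1) (fun r hr => (hP r hr).1) (fun r hr => (hP r hr).2.1)
      fun r hr => (hP r hr).2.2
    exact ⟨v, y, h, hv1, hy1, hv, hy, hh, heq', hP,
      exists_tendsto_nhdsGT_zero hα hv hy (fun r hr => heq' r hr.1) hr₂ hr₂h hb
        (fun r hr => (hB r ⟨hr.1, by linarith [hr.2]⟩).2.1.le) hC⟩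
  · have hK0 : 0 ≤ nonlinLip α := by
      unfold nonlinLip
      positivity
    have hK : ∀ x, 0 < x → x < nonlinRoot α →
        -nonlin α x ≤ nonlinLip α * (nonlinRoot α - x) := by
      intro x hx hxb
      have h1 := abs_nonlin_sub_le hα (M := nonlinRoot α) (x := x) (y := nonlinRoot α)
        (by rw [abs_of_pos hx]; exact hxb.le) (abs_of_pos hb).le
      rw [nonlin_nonlinRoot hα, sub_zero, abs_sub_comm, abs_of_pos (sub_pos.2 hxb)] at h1
      exact (neg_le_abs _).trans h1
    have hB := fun r (hr : r ∈ Ioo (0 : ℝ) 1) =>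
      bounds_of_pos hα hv1 hy1 hm hK hK0 hmK hv hy hM2 heq hr.1 hr.2
    have heq' := key fun r hr => (hB r hr).1
    have hv0 : ∀ r ∈ Ioo (0 : ℝ) 1, 0 < v r := fun r hr =>
      (sub_pos.2 hmK).trans_le (hB r hr).2.1
    refine ⟨v, y, h, hv1, hy1, hv, hy, hh, heq', fun r hr => ⟨hv0 r hr, ?_, ?_⟩,
      exists_tendsto_nhdsGT_zero hα hv hy (fun r hr => heq' r hr.1) (r₂ := 1 / 2)
        (by norm_num) le_rfl (sub_pos.2 hmK)
        (fun r hr => (hB r ⟨hr.1, by linarith [hr.2]⟩).2.1)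
        fun r hr => (hB r ⟨hr.1, by linarith [hr.2]⟩).2.2.1.le⟩
    · nlinarith [hrα r hr, (hB r hr).2.2.1, hv0 r hr]
    · have h1 := mul_pos hα (hv0 r hr)
      have h2 := mul_pos hr.1 (hB r hr).2.2.2
      linarith

theorem exists_global_solution {α a : ℝ} (hα : 0 < α)
    (ha : -(α * nonlinRoot α) - nonlinRoot α * Real.exp (-nonlinLip α) < a) (ha0 : a < 0) :
    ∃ U U' U'' : ℝ → ℝ, (∀ x, 0 < x → HasDerivAt U (U' x) x) ∧
      (∀ x, 0 < x → HasDerivAt U' (U'' x) x) ∧ ContinuousOn U'' (Ioi 0) ∧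
      (∀ x, 0 < x → (1 - x ^ 2) * (U'' x + 2 * (α + 1) * U' x / x) + nonlin α (U x) = 0) ∧
      U 1 = nonlinRoot α ∧ U' 1 = a ∧
      (∀ x, 1 < x → 0 < U x ∧ U x < nonlinRoot α ∧ U' x < 0) ∧
      ∃ L > 0, Tendsto (fun x => x ^ α * U x) atTop (nhds L) ∧
        Tendsto (fun x => x ^ (α + 1) * U' x) atTop (nhds (-α * L)) := by
  obtain ⟨v, y, h, hv1, hy1, hv, hy, hh, heq, hP, L, hL, hvL, hyL⟩ :=
    exists_profile (m := -(α * nonlinRoot α) - a) hα (by linarith) (by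
      have h1 := mul_lt_mul_of_pos_right
        (show -(α * nonlinRoot α) - a < nonlinRoot α * Real.exp (-nonlinLip α) by linarith)
        (Real.exp_pos (nonlinLip α))
      rwa [mul_assoc, ← Real.exp_add, neg_add_cancel, Real.exp_zero, mul_one] at h1)
  have hinv : ∀ x : ℝ, 0 < x → HasDerivAt (fun z : ℝ => z⁻¹) (-(x ^ 2)⁻¹) x := fun x hx =>
    hasDerivAt_inv hx.ne'
  have hvi : ∀ x : ℝ, 0 < x → HasDerivAt (fun z => v z⁻¹) (y x⁻¹ * -(x ^ 2)⁻¹) x := fun x hx =>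
    (hv _ (inv_pos.2 hx)).comp x (hinv x hx)
  have hyi : ∀ x : ℝ, 0 < x → HasDerivAt (fun z => y z⁻¹) (h x⁻¹ * -(x ^ 2)⁻¹) x := fun x hx =>
    (hy _ (inv_pos.2 hx)).comp x (hinv x hx)
  have hU : ∀ x : ℝ, 0 < x → HasDerivAt (fun z => z ^ (-α) * v z⁻¹)
      (-(x ^ (-α - 1) * (α * v x⁻¹ + x⁻¹ * y x⁻¹))) x := by
    intro x hx
    refine ((Real.hasDerivAt_rpow_const (p := -α) (Or.inl hx.ne')).mul (hvi x hx)).congr_deriv ?_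
    rw [Real.rpow_sub_one hx.ne']
    field_simp
    ring
  have hU' : ∀ x : ℝ, 0 < x → HasDerivAt (fun z => -(z ^ (-α - 1) * (α * v z⁻¹ + z⁻¹ * y z⁻¹)))
      (x ^ (-α - 1 - 1) * ((α + 1) * (α * v x⁻¹ + x⁻¹ * y x⁻¹) + (α + 1) * (x⁻¹ * y x⁻¹) +
        (x ^ 2)⁻¹ * h x⁻¹)) x := by
    intro x hx
    refine ((Real.hasDerivAt_rpow_const (p := -α - 1) (Or.inl hx.ne')).mul
      (((hvi x hx).const_mul α).add ((hinv x hx).mul (hyi x hx)))).neg.congr_deriv ?_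
    rw [Real.rpow_sub_one hx.ne' (-α - 1)]
    simp only [Pi.add_apply, Pi.mul_apply]
    field_simp
    ring
  have hneg : ∀ x : ℝ, 0 < x → x ^ (-α) = x⁻¹ ^ α := fun x hx => by
    rw [Real.rpow_neg hx.le, Real.inv_rpow hx.le]
  have hcancel : ∀ x : ℝ, 0 < x → x ^ (α + 1) * x ^ (-α - 1) = 1 := fun x hx => by
    rw [← Real.rpow_add hx, show α + 1 + (-α - 1) = 0 by ring, Real.rpow_zero]
  refine ⟨_, _, _, hU, hU', ?_, fun x hx => ?_, ?_, ?_, fun x hx => ?_, L, hL, ?_, ?_⟩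
  · intro x hx
    have hx0 : (0 : ℝ) < x := hx
    have h1 : ContinuousAt (fun z : ℝ => z⁻¹) x := (hinv x hx0).continuousAt
    have h2 : ContinuousAt (fun z => h z⁻¹) x :=
      ContinuousAt.comp (f := fun z : ℝ => z⁻¹) (g := h)
        (hh.continuousAt (Ioi_mem_nhds (inv_pos.2 hx0))) h1
    have h3 : ContinuousAt (fun z : ℝ => z ^ (-α - 1 - 1)) x :=
      Real.continuousAt_rpow_const x _ (Or.inl hx0.ne')
    have h4 := (hvi x hx0).continuousAt
    have h5 := (hyi x hx0).continuousAt
    have h6 : ContinuousAt (fun z : ℝ => (z ^ 2)⁻¹) x :=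
      ((continuous_pow 2).continuousAt).inv₀ (by positivity)
    have h7 := h1.mul h5
    exact (h3.mul (((continuousAt_const.mul ((continuousAt_const.mul h4).add h7)).add
      (continuousAt_const.mul h7)).add (h6.mul h2))).continuousWithinAt
  · have h1 := heq x⁻¹ (inv_pos.2 hx)
    have hx0 := hx.ne'
    have h2 : |x ^ (-α) * v x⁻¹| ^ (2 / α) = (x ^ 2)⁻¹ * |v x⁻¹| ^ (2 / α) := by
      rw [abs_mul, abs_of_pos (Real.rpow_pos_of_pos hx _), Real.mul_rpow (by positivity)
        (abs_nonneg _), ← Real.rpow_mul hx.le,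
        show -α * (2 / α) = -((2 : ℕ) : ℝ) by push_cast; field_simp, Real.rpow_neg hx.le,
        Real.rpow_natCast]
    unfold nonlin at h1 ⊢
    rw [h2, Real.rpow_sub_one hx0, Real.rpow_sub_one hx0]
    field_simp at h1 ⊢
    linear_combination (-x ^ (-α)) * h1
  · simp [hv1]
  · simp [hv1, hy1]
  · have hx0 := one_pos.trans hx
    have hI : x⁻¹ ∈ Ioo (0 : ℝ) 1 := ⟨inv_pos.2 hx0, inv_lt_one_of_one_lt₀ hx⟩
    obtain ⟨h1, h2, h3⟩ := hP _ hI
    refine ⟨mul_pos (Real.rpow_pos_of_pos hx0 _) h1, ?_,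
      neg_lt_zero.2 (mul_pos (Real.rpow_pos_of_pos hx0 _) h3)⟩
    rwa [hneg x hx0]
  · refine (hvL.comp tendsto_inv_atTop_nhdsGT_zero).congr' ?_
    filter_upwards [eventually_gt_atTop 0] with x hx
    rw [← mul_assoc, ← Real.rpow_add hx, add_neg_cancel, Real.rpow_zero, one_mul,
      Function.comp_apply]
  · have h1 := ((hvL.const_mul α).add hyL).neg.comp tendsto_inv_atTop_nhdsGT_zero
    rw [add_zero, ← neg_mul] at h1
    refine h1.congr' ?_
    filter_upwards [eventually_gt_atTop 0] with x hx
    simp only [Function.comp_apply]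
    linear_combination (α * v x⁻¹ + x⁻¹ * y x⁻¹) * hcancel x hx

section BlowUp

variable {α a σ : ℝ} {U y g : ℝ → ℝ}

theorem nonlinRoot_lt_and_le_of_pos (hα : 0 < α) (hσ : 1 < σ) (hU1 : U 1 = nonlinRoot α)
    (hy1 : y 1 = a) (ha : 0 < a) (hU : ∀ x ∈ Ico 1 σ, HasDerivAt U (y x) x)
    (hy : ∀ x ∈ Ico 1 σ, HasDerivAt y (g x) x)
    (heq : ∀ x ∈ Ioo 1 σ, (1 - x ^ 2) * (g x + 2 * (α + 1) * y x / x) + nonlin α (U x) = 0) :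
    ∀ x ∈ Ioo 1 σ, nonlinRoot α < U x ∧ a ≤ x ^ (2 * α + 2) * y x := by
  have hQ : ∀ r ∈ Ioo 1 σ, (∀ s ∈ Ioo 1 r, 0 < U s - nonlinRoot α) →
      ∀ s ∈ Icc 1 r, a ≤ s ^ (2 * α + 2) * y s := by
    intro r hr hpos s hs
    have hm : MonotoneOn (fun s => s ^ (2 * α + 2) * y s) (Icc 1 r) := by
      refine monotoneOn_Icc_of_hasDerivAt (fun s hs => hasDerivAt_rpow_mul
        (one_pos.trans_le hs.1) (hy s ⟨hs.1, hs.2.trans_lt hr.2⟩)) fun s hs => ?_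
      have hs0 : 0 < s := one_pos.trans hs.1
      refine mul_nonneg (Real.rpow_nonneg hs0.le _) ?_
      have h1 := heq s ⟨hs.1, hs.2.trans hr.2⟩
      have h2 := nonlin_pos hα (sub_pos.1 (hpos s hs))
      have h3 : 0 < s ^ 2 - 1 := by nlinarith [hs.1]
      have h4 : 0 ≤ g s + 2 * (α + 1) * y s / s := by
        refine (pos_of_mul_pos_right (a := s ^ 2 - 1) ?_ h3.le).le
        linarith
      have h5 := mul_nonneg hs0.le h4
      have h6 : s * (g s + 2 * (α + 1) * y s / s) = (2 * α + 2) * y s + s * g s := by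
        field_simp
        ring
      rwa [h6] at h5
    have h1 := hm (left_mem_Icc.2 hr.1.le) hs hs.1
    simpa [hy1] using h1
  have hypos : ∀ s, 1 ≤ s → a ≤ s ^ (2 * α + 2) * y s → 0 < y s := fun s hs h =>
    pos_of_mul_pos_right (ha.trans_le h) (Real.rpow_nonneg (by linarith) _)
  have hlow := forall_pos_of_step_right (f := fun x => U x - nonlinRoot α) (a := 1) (σ := σ)
    (fun x hx => (hU x ⟨hx.1.le, hx.2⟩).continuousAt.continuousWithinAt.sub
      continuousWithinAt_const) ?_ ?_
  · intro x hx
    refine ⟨sub_pos.1 (hlow x hx), hQ x hx (fun s hs => hlow s ⟨hs.1, hs.2.trans hx.2⟩) x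
      (right_mem_Icc.2 hx.1.le)⟩
  · filter_upwards [(hU 1 ⟨le_rfl, hσ⟩).eventually_lt_right (by rwa [hy1])] with z hz
    linarith
  · intro r hr hpos
    have hm : MonotoneOn U (Icc 1 r) :=
      monotoneOn_Icc_of_hasDerivAt (fun s hs => hU s ⟨hs.1, hs.2.trans_lt hr.2⟩) fun s hs =>
        (hypos s hs.1.le (hQ r hr hpos s ⟨hs.1.le, hs.2.le⟩)).le
    have h1 : (1 + r) / 2 ∈ Ioo 1 r := ⟨by linarith [hr.1], by linarith [hr.1]⟩
    have h2 := hm ⟨h1.1.le, h1.2.le⟩ (right_mem_Icc.2 hr.1.le) h1.2.le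
    linarith [hpos _ h1]

/-- The constant `ε` in the differential inequality `x U' > ε U (U^{1/α} - b^{1/α})`. -/
noncomputable def barrierConst (α : ℝ) : ℝ :=
  min (nonlinRoot α ^ (1 / α) / (2 * α + 1)) (α / (α + 1))

theorem barrierConst_pos (hα : 0 < α) : 0 < barrierConst α :=
  lt_min (div_pos (Real.rpow_pos_of_pos (nonlinRoot_pos hα) _) (by positivity)) (by positivity)

theorem barrier_lt (hα : 0 < α) (hσ : 1 < σ) (hU1 : U 1 = nonlinRoot α)
    (hy1 : y 1 = a) (ha : 0 < a) (hU : ∀ x ∈ Ico 1 σ, HasDerivAt U (y x) x)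
    (hy : ∀ x ∈ Ico 1 σ, HasDerivAt y (g x) x)
    (heq : ∀ x ∈ Ioo 1 σ, (1 - x ^ 2) * (g x + 2 * (α + 1) * y x / x) + nonlin α (U x) = 0)
    (hlow : ∀ x ∈ Ioo 1 σ, nonlinRoot α < U x) :
    ∀ x ∈ Ioo 1 σ,
      barrierConst α * (U x * (U x ^ (1 / α) - nonlinRoot α ^ (1 / α))) < x * y x := by
  have hb := nonlinRoot_pos hα
  set ε := barrierConst α with hε
  set Y₀ := nonlinRoot α ^ (1 / α) with hY₀
  have hY₀0 : 0 < Y₀ := Real.rpow_pos_of_pos hb _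
  have hε0 : 0 < ε := barrierConst_pos hα
  have hε1 : ε * (2 * α + 1) ≤ Y₀ := (le_div_iff₀ (by positivity)).1 (min_le_left _ _)
  have hε2 : ε * (α + 1) ≤ α := (le_div_iff₀ (by positivity)).1 (min_le_right _ _)
  have hε3 : ε ≤ 1 := by nlinarith
  have hsq : ∀ x : ℝ, 0 < x → x ^ (2 / α) = x ^ (1 / α) * x ^ (1 / α) := fun x hx => by
    rw [← Real.rpow_add hx]
    ring_nf
  have hc : α * (α + 1) = Y₀ * Y₀ := by rw [hY₀, ← hsq _ hb, nonlinRoot_rpow hα]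
  set f : ℝ → ℝ := fun x => x * y x - ε * (U x * (U x ^ (1 / α) - Y₀)) with hf
  have hUpos : ∀ x ∈ Ico 1 σ, 0 < U x := by
    intro x hx
    rcases hx.1.eq_or_lt with h | h
    · rw [← h, hU1]
      exact hb
    · exact hb.trans (hlow x ⟨h, hx.2⟩)
  have hf' : ∀ x ∈ Ico 1 σ, HasDerivAt f
      (y x + x * g x - ε * (((1 + 1 / α) * U x ^ (1 / α) - Y₀) * y x)) x := by
    intro x hx
    have h0 := (hUpos x hx).ne'
    refine (((hasDerivAt_id x).mul (hy x hx)).sub (((hU x hx).mul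
      (((hU x hx).rpow_const (p := 1 / α) (Or.inl h0)).sub_const Y₀)).const_mul ε)).congr_deriv ?_
    rw [Real.rpow_sub_one h0]
    simp only [id]
    field_simp
    ring
  have hfc : ∀ x ∈ Ico 1 σ, ContinuousAt f x := fun x hx => (hf' x hx).continuousAt
  have h1mem : (1 : ℝ) ∈ Ico 1 σ := ⟨le_rfl, hσ⟩
  have hf1 : 0 < f 1 := by
    simp only [hf, hy1, hU1, ← hY₀]
    linarith
  suffices hpos : ∀ x ∈ Ioo 1 σ, 0 < f x from fun x hx => sub_pos.1 (hpos x hx)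
  refine forall_pos_of_step_right
    (fun x hx => (hfc x ⟨hx.1.le, hx.2⟩).continuousWithinAt)
    (nhdsWithin_le_nhds ((hfc 1 h1mem).eventually (lt_mem_nhds hf1))) fun x hx hfx => ?_
  have hx' : x ∈ Ico 1 σ := ⟨hx.1.le, hx.2⟩
  have hev : ∀ᶠ s in nhdsWithin x (Iio x), 0 < f s := by
    filter_upwards [Ioo_mem_nhdsLT hx.1] with s hs using hfx s hs
  by_contra hneg
  have hfx0 : f x = 0 := le_antisymm (not_lt.1 hneg)
    (ge_of_tendsto ((hfc x hx').tendsto.mono_left nhdsWithin_le_nhds) (hev.mono fun _ h => h.le))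
  have hx0 : 0 < x := one_pos.trans hx.1
  have hUx := hUpos x hx'
  have hxy : x * y x = ε * (U x * (U x ^ (1 / α) - Y₀)) := sub_eq_zero.1 hfx0
  have hYY : Y₀ < U x ^ (1 / α) := Real.rpow_lt_rpow hb.le (hlow x hx) (by positivity)
  have hderiv : 0 < y x + x * g x - ε * (((1 + 1 / α) * U x ^ (1 / α) - Y₀) * y x) := by
    have h1 := heq x hx
    rw [nonlin_of_pos hUx, hc, hsq _ hUx] at h1
    set Y := U x ^ (1 / α) with hY
    set Φ := U x * (Y - Y₀) with hΦ
    have hΦ0 : 0 < Φ := mul_pos hUx (sub_pos.2 hYY)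
    have h2 : 0 < x ^ 2 - 1 := by nlinarith [hx.1]
    have h3 : (x ^ 2 - 1) * (x ^ 2 * g x + 2 * (α + 1) * (x * y x)) = x ^ 2 * (Φ * (Y + Y₀)) := by
      have h4 : 2 * (α + 1) * y x / x * x ^ 2 = 2 * (α + 1) * (x * y x) := by
        field_simp
      rw [← h4, hΦ]
      linear_combination (-x ^ 2) * h1
    have h5 : Φ * (Y + Y₀) < x ^ 2 * g x + 2 * (α + 1) * (x * y x) := by
      refine lt_of_mul_lt_mul_left ?_ h2.le
      rw [h3]
      have : 0 < Φ * (Y + Y₀) := mul_pos hΦ0 (by linarith)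
      linarith
    have h6 : ε * (2 * α + 1 + ε * ((1 + 1 / α) * Y - Y₀)) ≤ Y + Y₀ := by
      have h7 : ε * (1 + 1 / α) ≤ 1 := by
        have : ε * (1 + 1 / α) = ε * (α + 1) / α := by field_simp
        rw [this]
        exact (div_le_one hα).2 hε2
      have hY0 : 0 < Y := hY₀0.trans hYY
      have h8 : ε * (ε * (1 + 1 / α)) ≤ 1 * 1 :=
        mul_le_mul hε3 h7 (by positivity) zero_le_one
      have h9 := mul_le_mul_of_nonneg_right h8 hY0.le
      have h10 : 0 ≤ ε * ε * Y₀ := by positivity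
      linarith
    have h11 := mul_le_mul_of_nonneg_left h6 hΦ0.le
    refine pos_of_mul_pos_right (a := x) ?_ hx0.le
    have h12 : x * (y x + x * g x - ε * (((1 + 1 / α) * Y - Y₀) * y x)) =
        (x ^ 2 * g x + 2 * (α + 1) * (x * y x)) -
          (2 * α + 1 + ε * ((1 + 1 / α) * Y - Y₀)) * (x * y x) := by
      ring
    rw [hxy] at h5
    rw [h12, hxy]
    linarith
  have hlt := (hf' x hx').eventually_lt_left hderiv
  obtain ⟨s, hs1, hs2⟩ := (hlt.and hev).exists
  linarith

theorem exists_le_of_pos (hα : 0 < α) (ha : 0 < a) :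
    ∃ T : ℝ, ∀ (σ : ℝ) (U y g : ℝ → ℝ), 1 < σ → U 1 = nonlinRoot α → y 1 = a →
      (∀ x ∈ Ico 1 σ, HasDerivAt U (y x) x) → (∀ x ∈ Ico 1 σ, HasDerivAt y (g x) x) →
      (∀ x ∈ Ioo 1 σ, (1 - x ^ 2) * (g x + 2 * (α + 1) * y x / x) + nonlin α (U x) = 0) →
      σ ≤ T := by
  have hb := nonlinRoot_pos hα
  set k := a / 2 ^ (2 * α + 2) with hk
  have hk0 : 0 < k := by positivity
  set Y₀ := nonlinRoot α ^ (1 / α) with hY₀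
  have hY₀0 : 0 < Y₀ := Real.rpow_pos_of_pos hb _
  set Y₁ := (nonlinRoot α + k) ^ (1 / α) with hY₁
  have hY₀₁ : Y₀ < Y₁ := Real.rpow_lt_rpow hb.le (by linarith) (by positivity)
  have hY₁0 : 0 < Y₁ := hY₀0.trans hY₀₁
  set κ := 1 - Y₀ / Y₁ with hκ
  have hκ0 : 0 < κ := sub_pos.2 ((div_lt_one hY₁0).2 hY₀₁)
  set ε := barrierConst α with hε
  have hε0 : 0 < ε := barrierConst_pos hα
  set S := α / (ε * κ * Y₁) with hS
  have hS0 : 0 < S := by positivity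
  refine ⟨2 * Real.exp S, fun σ U y g hσ hU1 hy1 hU hy heq => ?_⟩
  by_contra! hT
  set T := 2 * Real.exp S with hTdef
  have hT2 : 2 ≤ T := by
    have := Real.one_le_exp hS0.le
    linarith
  have hlow := nonlinRoot_lt_and_le_of_pos hα hσ hU1 hy1 ha hU hy heq
  have hbar := barrier_lt hα hσ hU1 hy1 ha hU hy heq fun x hx => (hlow x hx).1
  have hypos : ∀ x ∈ Ioo 1 σ, 0 < y x := fun x hx =>
    pos_of_mul_pos_right (ha.trans_le (hlow x hx).2) (Real.rpow_nonneg (by linarith [hx.1]) _)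
  have hU2 : nonlinRoot α + k ≤ U 2 := by
    have hm : MonotoneOn (fun x => U x - k * x) (Icc 1 2) := by
      refine monotoneOn_Icc_of_hasDerivAt (f' := fun x => y x - k * 1)
        (fun x hx => (hU x ⟨hx.1, by linarith [hx.2]⟩).sub ((hasDerivAt_id x).const_mul k))
        fun x hx => ?_
      have hxI : x ∈ Ioo 1 σ := ⟨hx.1, by linarith [hx.2]⟩
      have h1 := (hlow x hxI).2
      have h2 : x ^ (2 * α + 2) ≤ 2 ^ (2 * α + 2) :=
        Real.rpow_le_rpow (by linarith [hx.1]) hx.2.le (by positivity)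
      have h3 := h1.trans (mul_le_mul_of_nonneg_right h2 (hypos x hxI).le)
      have h4 : k ≤ y x := (div_le_iff₀ (by positivity)).2 (by linarith)
      linarith
    have := hm (left_mem_Icc.2 one_le_two) (right_mem_Icc.2 one_le_two) one_le_two
    simp only [hU1] at this
    linarith
  have hmem : ∀ x ∈ Icc 2 T, x ∈ Ioo 1 σ := fun x hx => ⟨by linarith [hx.1], by linarith [hx.2]⟩
  have hmem' : ∀ x ∈ Icc 2 T, x ∈ Ico 1 σ := fun x hx => ⟨by linarith [hx.1], by linarith [hx.2]⟩
  have hUm : MonotoneOn U (Icc 2 T) :=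
    monotoneOn_Icc_of_hasDerivAt (fun x hx => hU x (hmem' x hx)) fun x hx =>
      (hypos x (hmem x ⟨hx.1.le, hx.2.le⟩)).le
  have hUge : ∀ x ∈ Icc 2 T, nonlinRoot α + k ≤ U x := fun x hx =>
    hU2.trans (hUm (left_mem_Icc.2 hT2) hx hx.1)
  have hUpos : ∀ x ∈ Icc 2 T, 0 < U x := fun x hx => by linarith [hUge x hx]
  have hW : AntitoneOn (fun x => U x ^ (-(1 / α)) + ε * κ / α * Real.log x) (Icc 2 T) := by
    refine antitoneOn_Icc_of_hasDerivAt (fun x hx =>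
      ((hU x (hmem' x hx)).rpow_const (p := -(1 / α)) (Or.inl (hUpos x hx).ne')).add
        ((Real.hasDerivAt_log (by linarith [hx.1])).const_mul (ε * κ / α))) fun x hx => ?_
    have hxI : x ∈ Icc 2 T := ⟨hx.1.le, hx.2.le⟩
    have hx0 : 0 < x := by linarith [hx.1]
    have hUx := hUpos x hxI
    have h1 := hbar x (hmem x hxI)
    have hY : Y₁ ≤ U x ^ (1 / α) :=
      Real.rpow_le_rpow (by positivity) (hUge x hxI) (by positivity)
    rw [Real.rpow_sub_one hUx.ne', Real.rpow_neg hUx.le]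
    set Y := U x ^ (1 / α) with hYdef
    have hY0 : 0 < Y := hY₁0.trans_le hY
    have h2 : κ * Y ≤ Y - Y₀ := by
      have h3 : Y₀ ≤ Y₀ / Y₁ * Y := by
        rw [div_mul_eq_mul_div, le_div_iff₀ hY₁0]
        exact mul_le_mul_of_nonneg_left hY hY₀0.le
      rw [hκ]
      linarith
    have h4 : ε * κ * (U x * Y) ≤ x * y x := by
      have := mul_le_mul_of_nonneg_left h2 (mul_pos hε0 hUx).le
      linarith
    have h5 : y x * -(1 / α) * (Y⁻¹ / U x) + ε * κ / α * x⁻¹ =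
        (ε * κ * (U x * Y) - x * y x) / (α * x * (U x * Y)) := by
      field_simp
      ring
    rw [h5]
    exact div_nonpos_of_nonpos_of_nonneg (by linarith) (by positivity)
  have h1 := hW (left_mem_Icc.2 hT2) (right_mem_Icc.2 hT2) hT2
  simp only at h1
  have h2 : Real.log T = Real.log 2 + S := by
    rw [hTdef, Real.log_mul two_ne_zero (Real.exp_ne_zero _), Real.log_exp]
  have h3 : U 2 ^ (-(1 / α)) ≤ Y₁⁻¹ := by
    rw [Real.rpow_neg (hUpos 2 (left_mem_Icc.2 hT2)).le]
    exact inv_anti₀ hY₁0 (Real.rpow_le_rpow (by positivity) hU2 (by positivity))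
  have h4 : ε * κ / α * S = Y₁⁻¹ := by
    rw [hS]
    field_simp
  have h5 := Real.rpow_pos_of_pos (hUpos T (right_mem_Icc.2 hT2)) (-(1 / α))
  rw [h2, mul_add, h4] at h1
  linarith

end BlowUp

theorem isSolOn_iff_nonlin {N : ℕ} {p α : ℝ} (hα : alphaP p = α) (hp : p - 1 = 2 / α)
    (hN : (N : ℝ) - 1 = 2 * (α + 1)) {u : ℝ → ℝ} {s : Set ℝ} (hs : ∀ x ∈ s, x ≠ 0) :
    IsSolOn N p u s ↔ ∀ x ∈ s, (1 - x ^ 2) *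
      (deriv (deriv u) x + 2 * (α + 1) * deriv u x / x) + nonlin α (u x) = 0 := by
  unfold IsSolOn nonlin
  rw [hα, hp, hN]
  refine forall₂_congr fun x hx => ?_
  have h1 : 2 * (α + 1) / x - 2 * (α + 1) * x = (1 - x ^ 2) * (2 * (α + 1) / x) := by
    have := hs x hx
    field_simp
  rw [h1]
  constructor <;> intro h <;> rw [← h] <;> ring

theorem ContDiffOn.hasDerivAt_deriv_deriv {u : ℝ → ℝ} {s : Set ℝ} (hs : IsOpen s)
    (hu : ContDiffOn ℝ 2 u s) {x : ℝ} (hx : x ∈ s) :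
    HasDerivAt u (deriv u x) x ∧ HasDerivAt (deriv u) (deriv (deriv u) x) x := by
  rw [show (2 : WithTop ℕ∞) = 1 + 1 from rfl, contDiffOn_succ_iff_deriv_of_isOpen hs] at hu
  exact ⟨(hu.1.differentiableAt (hs.mem_nhds hx)).hasDerivAt,
    ((hu.2.2.differentiableOn one_ne_zero).differentiableAt (hs.mem_nhds hx)).hasDerivAt⟩

theorem stmt18 (N : ℕ) (p : ℝ) (hN : 4 ≤ N) (hp : p = 1 + 4 / ((N : ℝ) - 3)) :
    -- `a_* ∈ [-∞, -αb₀)`, encoded as an extended real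
    ∃ astar : EReal, astar < ((-(alphaP p) * b0 p : ℝ) : EReal) ∧
      ∀ a : ℝ,
        -- (i) if `a > 0`: every solution with `U(1) = b₀`, `U'(1) = a` blows
        -- up in finite time and stays above `b₀` to the right of `1`
        ((0 < a →
          (∃ T : ℝ, ∀ (τ σ : ℝ) (U : ℝ → ℝ), τ < 1 → 1 < σ →
            ContDiffOn ℝ 2 U (Ioo τ σ) → IsSolOn N p U (Ioo τ σ) →
            U 1 = b0 p → deriv U 1 = a → σ ≤ T) ∧
          (∀ (τ σ : ℝ) (U : ℝ → ℝ), τ < 1 → 1 < σ →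
            ContDiffOn ℝ 2 U (Ioo τ σ) → IsSolOn N p U (Ioo τ σ) →
            U 1 = b0 p → deriv U 1 = a →
            ∀ x ∈ Ioo (1 : ℝ) σ, b0 p < U x)) ∧
        -- (ii) if `a_* < a < 0`: the solution is global with the stated
        -- asymptotics
        (astar < (a : EReal) → a < 0 →
          ∃ U : ℝ → ℝ,
            ContDiffOn ℝ 2 U (Ioi 0) ∧ IsSolOn N p U (Ioi 0) ∧
            U 1 = b0 p ∧ deriv U 1 = a ∧
            (∀ x : ℝ, 1 < x → 0 < U x ∧ U x < b0 p ∧ deriv U x < 0) ∧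
            ∃ L > 0,
              Tendsto (fun x => x ^ alphaP p * U x) atTop (nhds L) ∧
              Tendsto (fun x => x ^ (alphaP p + 1) * deriv U x) atTop
                (nhds (-(alphaP p) * L)))) := by
  have hN3 : (0 : ℝ) < (N : ℝ) - 3 := by
    have : (4 : ℝ) ≤ N := by exact_mod_cast hN
    linarith
  obtain ⟨α, hαdef⟩ : ∃ α : ℝ, α = ((N : ℝ) - 3) / 2 := ⟨_, rfl⟩
  have hα : 0 < α := by
    rw [hαdef]
    positivity
  have hN1 : (N : ℝ) - 1 = 2 * (α + 1) := by
    rw [hαdef]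
    ring
  have hp1 : p - 1 = 2 / α := by
    rw [hp, hαdef]
    field_simp
    ring
  have hαP : alphaP p = α := by
    rw [alphaP, hp1]
    field_simp
  have hb0 : b0 p = nonlinRoot α := by
    have h1 : 2 * (p + 1) / (p - 1) ^ 2 = α * (α + 1) := by
      rw [show p + 1 = (p - 1) + 2 by ring, hp1]
      field_simp
      ring
    have h2 : 1 / (p - 1) = α / 2 := by
      rw [hp1]
      field_simp
    rw [b0, nonlinRoot, h1, h2]
  have hb := nonlinRoot_pos hα
  refine ⟨((-(α * nonlinRoot α) - nonlinRoot α * Real.exp (-nonlinLip α) : ℝ) : EReal), ?_,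
    fun a => ⟨fun ha => ?_, fun ha ha0 => ?_⟩⟩
  · rw [EReal.coe_lt_coe_iff, hαP, hb0]
    have := mul_pos hb (Real.exp_pos (-nonlinLip α))
    linarith
  · have hder : ∀ {τ σ : ℝ} {U : ℝ → ℝ}, τ < 1 → ContDiffOn ℝ 2 U (Ioo τ σ) →
        ∀ x ∈ Ico 1 σ, HasDerivAt U (deriv U x) x ∧
          HasDerivAt (deriv U) (deriv (deriv U) x) x := fun hτ hU x hx =>
      hU.hasDerivAt_deriv_deriv isOpen_Ioo ⟨hτ.trans_le hx.1, hx.2⟩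
    have hode : ∀ {τ σ : ℝ} {U : ℝ → ℝ}, τ < 1 → IsSolOn N p U (Ioo τ σ) →
        ∀ x ∈ Ioo 1 σ, (1 - x ^ 2) * (deriv (deriv U) x + 2 * (α + 1) * deriv U x / x) +
          nonlin α (U x) = 0 := fun hτ hS =>
      (isSolOn_iff_nonlin hαP hp1 hN1 fun x hx => (one_pos.trans hx.1).ne').1
        fun x hx => hS x ⟨hτ.trans hx.1, hx.2⟩
    rw [hb0]
    obtain ⟨T, hT⟩ := exists_le_of_pos hα ha
    refine ⟨⟨T, fun τ σ U hτ hσ hU hS hU1 hU'1 => ?_⟩, fun τ σ U hτ hσ hU hS hU1 hU'1 x hx => ?_⟩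
    · exact hT σ U _ _ hσ hU1 hU'1 (fun x hx => (hder hτ hU x hx).1)
        (fun x hx => (hder hτ hU x hx).2) (hode hτ hS)
    · exact (nonlinRoot_lt_and_le_of_pos hα hσ hU1 hU'1 ha (fun x hx => (hder hτ hU x hx).1)
        (fun x hx => (hder hτ hU x hx).2) (hode hτ hS) x hx).1
  · obtain ⟨U, U', U'', hU, hU', hU'', heq, hU1, hU'1, hlt, L, hL, hL1, hL2⟩ :=
      exists_global_solution hα (EReal.coe_lt_coe_iff.1 ha) ha0
    have hd : ∀ x, 0 < x → deriv U x = U' x := fun x hx => (hU x hx).deriv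
    have hdd : ∀ x, 0 < x → deriv (deriv U) x = U'' x := fun x hx => by
      have h1 : deriv U =ᶠ[nhds x] U' := by
        filter_upwards [Ioi_mem_nhds hx] with z hz using hd z hz
      rw [h1.deriv_eq, (hU' x hx).deriv]
    rw [hαP, hb0]
    refine ⟨U, contDiffOn_two_of_hasDerivAt isOpen_Ioi hU hU' hU'', ?_, hU1, ?_, fun x hx => ?_,
      L, hL, hL1, hL2.congr' ?_⟩
    · refine (isSolOn_iff_nonlin hαP hp1 hN1 fun x hx => ne_of_gt hx).2 fun x hx => ?_
      rw [hd x hx, hdd x hx]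
      exact heq x hx
    · rw [hd 1 one_pos, hU'1]
    · rw [hd x (one_pos.trans hx)]
      exact hlt x hx
    · filter_upwards [eventually_gt_atTop 0] with x hx
      rw [hd x hx]
end

section
/- Assume N = 3 and p > 5, or N ≥ 4 and 1 + 4/(N−2) < p ≤ 1 + 4/(N−3). Define B̃(ρ) = ((p+3)/(p−1) − (N−2)ρ^{−2}) / (1 − ρ^{−2}) for ρ > 1, β_{N,p} = ((2N−8)p² + (24−12N)p + 10N)/(p−1)², and ρ_{N,p} > 1 by ρ_{N,p}^{−2} = (−β_{N,p} − √(β_{N,p}² − 4(N−2)²)) / (2(N−2)²) (one has β_{N,p} ≤ −2(N−2), so ρ_{N,p} is well defined). Let ρ₀ > 1, let U be a C² solution of (PDE) in a neighborhood of ρ₀, and let [ρ₀, ρ₊) be its forward maximal interval of existence. Assume 0 < U(ρ₀) < b_∞, U′(ρ₀) < 0, ρ₀ U′(ρ₀)/U(ρ₀) > −B̃(ρ₀)/2, and ρ₀ > ρ_{N,p}. Then ρ₊ = +∞, and for all ρ > ρ₀ one has U(ρ) > 0 and ρ U′(ρ)/U(ρ) > −B̃(ρ)/2. -/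
open Set Filter

/-- `B̃(ρ) = ((p+3)/(p-1) - (N-2)ρ⁻²)/(1 - ρ⁻²)`. -/
noncomputable def Btilde (N : ℕ) (p : ℝ) (ρ : ℝ) : ℝ :=
  ((p + 3) / (p - 1) - ((N : ℝ) - 2) / ρ ^ 2) / (1 - 1 / ρ ^ 2)

/-- `β_{N,p} = ((2N-8)p² + (24-12N)p + 10N)/(p-1)²`. -/
noncomputable def betaNP (N : ℕ) (p : ℝ) : ℝ :=
  ((2 * (N : ℝ) - 8) * p ^ 2 + (24 - 12 * (N : ℝ)) * p + 10 * (N : ℝ)) / (p - 1) ^ 2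

/-- `ρ_{N,p}`, defined by `ρ_{N,p}⁻² = (-β - √(β² - 4(N-2)²))/(2(N-2)²)`. -/
noncomputable def rhoNP (N : ℕ) (p : ℝ) : ℝ :=
  (Real.sqrt ((-betaNP N p - Real.sqrt ((betaNP N p) ^ 2 - 4 * ((N : ℝ) - 2) ^ 2)) /
    (2 * ((N : ℝ) - 2) ^ 2)))⁻¹

open scoped Topology NNReal

/-- A function that is positive before `b` and vanishes at `b` has nonpositive left derivative. -/
lemma nonpos_of_hasDerivWithinAt_of_pos {f : ℝ → ℝ} {f' a b : ℝ} (hab : a < b)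
    (hf : HasDerivWithinAt f f' (Icc a b) b) (hb : f b = 0) (hpos : ∀ t ∈ Ico a b, 0 < f t) :
    f' ≤ 0 := by
  have h := (hasDerivWithinAt_iff_tendsto_slope.1 hf).mono_left
    (nhdsWithin_mono b (fun t ht => ⟨Ico_subset_Icc_self ht, ht.2.ne⟩ : Ico a b ⊆ Icc a b \ {b}))
  have : (𝓝[Ico a b] b).NeBot := by
    rw [nhdsWithin_Ico_eq_nhdsLT hab]; infer_instance
  refine le_of_tendsto h ?_
  filter_upwards [self_mem_nhdsWithin] with t ht
  rw [slope_def_field, hb]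
  exact div_nonpos_of_nonneg_of_nonpos (by linarith [hpos t ht]) (by linarith [ht.2])

/-- Picard–Lindelöf for a bounded, globally Lipschitz vector field: the solution exists on the
whole time interval. -/
lemma exists_solution_of_lipschitz_of_bounded {E : Type*} [NormedAddCommGroup E] [NormedSpace ℝ E]
    [CompleteSpace E] {f : ℝ → E → E} {a b : ℝ} (hab : a ≤ b) {K C : ℝ≥0}
    (hlip : ∀ t ∈ Icc a b, LipschitzWith K (f t)) (hcont : ∀ x, ContinuousOn (f · x) (Icc a b))
    (hC : ∀ t ∈ Icc a b, ∀ x, ‖f t x‖ ≤ C) (x₀ : E) :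
    ∃ y : ℝ → E, y a = x₀ ∧ ∀ t ∈ Icc a b, HasDerivWithinAt y (f t (y t)) (Icc a b) t := by
  have h : IsPicardLindelof f (⟨a, left_mem_Icc.2 hab⟩ : Icc a b) x₀
      (C * (b - a).toNNReal) 0 C K :=
    { lipschitzOnWith := fun t ht => (hlip t ht).lipschitzOnWith
      continuousOn := fun x _ => hcont x
      norm_le := fun t ht x _ => hC t ht x
      mul_max_le := by simp [hab] }
  exact h.exists_eq_forall_mem_Icc_hasDerivWithinAt₀

/-- The second derivative prescribed by the profile equation for a nonnegative solution,
with `n = N - 2`. -/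
noncomputable def profileAccel (α n p t u v : ℝ) : ℝ :=
  (u ^ p - α * (α + 1) * u + ((n + 1) / t - 2 * (α + 1) * t) * v) / (t ^ 2 - 1)

/-- The first-order vector field of the profile equation. -/
noncomputable def profileField (α n p t : ℝ) (x : ℝ × ℝ) : ℝ × ℝ :=
  (x.2, profileAccel α n p t x.1 x.2)

/-- A positive multiple of `t * v / u + Btilde t / 2`, for positive `u`. -/
def barrier (α n t u v : ℝ) : ℝ := 2 * t * (t ^ 2 - 1) * v + ((1 + 2 * α) * t ^ 2 - n) * u

/-- The region of phase space that is invariant under the profile equation. -/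
def InRegion (α n M t u v : ℝ) : Prop := 0 < u ∧ u < M ∧ v < 0 ∧ 0 < barrier α n t u v

/-- `(y, v)` solves the first-order system on `[a, b]` and stays in the invariant region. -/
def IsProfileSol (α n p M a b : ℝ) (y v : ℝ → ℝ) : Prop :=
  ∀ t ∈ Icc a b, InRegion α n M t (y t) (v t) ∧ HasDerivWithinAt y (v t) (Icc a b) t ∧
    HasDerivWithinAt v (profileAccel α n p t (y t) (v t)) (Icc a b) t

lemma neg_mul_le_of_barrier_nonneg {α n a b t u v : ℝ} (hα : 0 < α) (hn : 0 < n) (ha : 1 < a)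
    (ht : t ∈ Icc a b) (hu : 0 ≤ u) (hv : v ≤ 0) (h : 0 ≤ barrier α n t u v) :
    -((1 + 2 * α) * b ^ 2 / (2 * a * (a ^ 2 - 1)) * u) ≤ v := by
  have ha2 : 0 < a ^ 2 - 1 := by nlinarith
  have h1 : 2 * a * (a ^ 2 - 1) ≤ 2 * t * (t ^ 2 - 1) := by
    have h0 := ht.1
    have : 0 ≤ 2 * t := by linarith
    gcongr
  have h2 : (1 + 2 * α) * t ^ 2 * u ≤ (1 + 2 * α) * b ^ 2 * u := by
    have := ht.1
    have := ht.2
    gcongr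
    linarith
  have h3 : 0 < 2 * a * (a ^ 2 - 1) := by positivity
  unfold barrier at h
  rw [neg_le, div_mul_eq_mul_div, le_div_iff₀ h3]
  nlinarith [mul_nonneg hn.le hu, mul_le_mul_of_nonneg_left h1 (neg_nonneg.2 hv)]

lemma barrier_deriv_pos {α n p t u v : ℝ} (ht : 1 < t) (hu : 0 < u)
    (hpoly : 0 < t ^ 4 + (n * (2 - 4 * α) - 4 - 4 * α + 4 * α ^ 2) * t ^ 2 + n ^ 2)
    (h : barrier α n t u v = 0) :
    0 < (6 * t ^ 2 - 2) * v + 2 * t * (t ^ 2 - 1) * profileAccel α n p t u v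
      + (2 * (1 + 2 * α) * t * u + ((1 + 2 * α) * t ^ 2 - n) * v) := by
  have ht2 : 0 < t ^ 2 - 1 := by nlinarith
  have ht0 : 0 < t := by linarith
  have hup : 0 < u ^ p := Real.rpow_pos_of_pos hu p
  have key : 2 * t * (t ^ 2 - 1) * profileAccel α n p t u v =
      2 * t * u ^ p - 2 * t * (α * (α + 1)) * u + (2 * (n + 1) - 4 * (α + 1) * t ^ 2) * v := by
    unfold profileAccel
    field_simp
    ring
  rw [key]
  unfold barrier at h
  have h3 : 0 < 2 * t * (t ^ 2 - 1) := by positivity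
  refine pos_of_mul_pos_right (a := 2 * t * (t ^ 2 - 1)) ?_ h3.le
  have hv : 2 * t * (t ^ 2 - 1) * v = -(((1 + 2 * α) * t ^ 2 - n) * u) := by linarith
  have : 2 * t * (t ^ 2 - 1) * ((6 * t ^ 2 - 2) * v + (2 * t * u ^ p - 2 * t * (α * (α + 1)) * u
      + (2 * (n + 1) - 4 * (α + 1) * t ^ 2) * v)
      + (2 * (1 + 2 * α) * t * u + ((1 + 2 * α) * t ^ 2 - n) * v)) =
      u * (t ^ 4 + (n * (2 - 4 * α) - 4 - 4 * α + 4 * α ^ 2) * t ^ 2 + n ^ 2)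
        + 4 * t ^ 2 * (t ^ 2 - 1) * u ^ p := by
    linear_combination ((3 - 2 * α) * t ^ 2 + n) * hv
  rw [this]
  positivity

/-- Continuation argument: a trajectory starting in the invariant region never leaves it. It
suffices that the differential equations hold as long as the closed bounds do. -/
lemma isProfileSol_of_inRegion_left {α n p M a b : ℝ} {y v : ℝ → ℝ} (hα : 0 < α) (hn : 0 < n)
    (ha : 1 < a) (hM : ∀ u, 0 < u → u < M → u ^ (p - 1) < α * (α + 1))
    (hpoly : ∀ t, a ≤ t → 0 < t ^ 4 + (n * (2 - 4 * α) - 4 - 4 * α + 4 * α ^ 2) * t ^ 2 + n ^ 2)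
    (hy : ContinuousOn y (Icc a b)) (hv : ContinuousOn v (Icc a b))
    (hode : ∀ t ∈ Icc a b, 0 ≤ y t → y t ≤ M → v t ≤ 0 →
      -((1 + 2 * α) * b ^ 2 / (2 * a * (a ^ 2 - 1)) * M) ≤ v t →
      HasDerivWithinAt y (v t) (Icc a b) t ∧
        HasDerivWithinAt v (profileAccel α n p t (y t) (v t)) (Icc a b) t)
    (h0 : InRegion α n M a (y a) (v a)) :
    IsProfileSol α n p M a b y v := by
  have hcoef : 0 ≤ (1 + 2 * α) * b ^ 2 / (2 * a * (a ^ 2 - 1)) := by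
    have : 0 < a ^ 2 - 1 := by nlinarith
    positivity
  set C := (1 + 2 * α) * b ^ 2 / (2 * a * (a ^ 2 - 1)) with hC
  have hode' : ∀ t ∈ Icc a b, 0 ≤ y t → y t ≤ M → v t ≤ 0 → 0 ≤ barrier α n t (y t) (v t) →
      HasDerivWithinAt y (v t) (Icc a b) t ∧
        HasDerivWithinAt v (profileAccel α n p t (y t) (v t)) (Icc a b) t := by
    intro t ht h1 h2 h3 h4
    refine hode t ht h1 h2 h3 (le_trans ?_ (neg_mul_le_of_barrier_nonneg hα hn ha ht h1 h3 h4))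
    rw [neg_le_neg_iff]
    gcongr
  have hbar : ContinuousOn (fun t => barrier α n t (y t) (v t)) (Icc a b) := by
    unfold barrier
    fun_prop
  suffices H : ∀ t ∈ Icc a b, InRegion α n M t (y t) (v t) by
    intro t ht
    obtain ⟨h1, h2, h3, h4⟩ := H t ht
    exact ⟨H t ht, hode' t ht h1.le h2.le h3.le h4.le⟩
  let r : ℝ → ℝ := fun t => min (min (y t) (M - y t)) (min (-v t) (barrier α n t (y t) (v t)))
  have hr : ∀ t, 0 < r t ↔ InRegion α n M t (y t) (v t) := by
    intro t
    simp only [r, lt_min_iff, sub_pos, InRegion, Left.neg_pos_iff]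
    tauto
  have hrc : ContinuousOn r (Icc a b) := by
    have := continuousOn_const (c := M) (s := Icc a b)
    exact (hy.inf (this.sub hy)).inf (hv.neg.inf hbar)
  by_contra! hcon
  obtain ⟨t₁, ht₁, hfail⟩ := hcon
  have hcomp : IsCompact (Icc a b ∩ r ⁻¹' Iic 0) :=
    isCompact_Icc.of_isClosed_subset (hrc.preimage_isClosed_of_isClosed isClosed_Icc isClosed_Iic)
      inter_subset_left
  obtain ⟨T, ⟨hT, hTr⟩, hTmin⟩ := hcomp.exists_isLeast
    ⟨t₁, ht₁, not_lt.1 fun h => hfail ((hr t₁).1 h)⟩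
  have hTfail : ¬ InRegion α n M T (y T) (v T) := fun h => not_lt.2 hTr ((hr T).2 h)
  have haT : a < T := hT.1.lt_of_ne (by rintro rfl; exact hTfail h0)
  have hsub : Icc a T ⊆ Icc a b := Icc_subset_Icc_right hT.2
  have hbefore : ∀ t ∈ Ico a T, InRegion α n M t (y t) (v t) := fun t ht =>
    (hr t).1 (not_le.1 fun h => not_le.2 ht.2 (hTmin ⟨hsub (Ico_subset_Icc_self ht), h⟩))
  have hcl : ∀ f : ℝ → ℝ, ContinuousOn f (Icc a b) → (∀ t ∈ Ico a T, 0 ≤ f t) → 0 ≤ f T := by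
    intro f hf hpos
    have : (𝓝[Ico a T] T).NeBot := by
      rw [nhdsWithin_Ico_eq_nhdsLT haT]; infer_instance
    refine ge_of_tendsto (((hf T hT).mono (Ico_subset_Icc_self.trans hsub)).tendsto) ?_
    filter_upwards [self_mem_nhdsWithin] with t ht using hpos t ht
  have hTv : v T ≤ 0 := neg_nonneg.1 (hcl _ hv.neg fun t ht => by
    have := (hbefore t ht).2.2.1
    simp only [Pi.neg_apply]
    linarith)
  have hTb : 0 ≤ barrier α n T (y T) (v T) := hcl _ hbar fun t ht => (hbefore t ht).2.2.2.le
  have hder : ∀ t ∈ Ico a T, HasDerivWithinAt y (v t) (Icc a b) t := fun t ht => by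
    obtain ⟨h1, h2, h3, h4⟩ := hbefore t ht
    exact (hode' t (hsub (Ico_subset_Icc_self ht)) h1.le h2.le h3.le h4.le).1
  have hTM : y T < M := by
    have hanti : AntitoneOn y (Icc a T) := by
      refine antitoneOn_of_hasDerivWithinAt_nonpos (f' := v) (convex_Icc a T) (hy.mono hsub)
        (fun t ht => ?_) (fun t ht => ?_) <;> rw [interior_Icc] at *
      · exact (hder t (Ioo_subset_Ico_self ht)).mono (Ioo_subset_Icc_self.trans hsub)
      · exact (hbefore t (Ioo_subset_Ico_self ht)).2.2.1.le
    exact (hanti (left_mem_Icc.2 haT.le) (right_mem_Icc.2 haT.le) haT.le).trans_lt h0.2.1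
  have hTy : 0 < y T := by
    have hmono : MonotoneOn (fun t => y t * Real.exp (C * t)) (Icc a T) := by
      refine monotoneOn_of_hasDerivWithinAt_nonneg
        (f' := fun t => v t * Real.exp (C * t) + y t * (Real.exp (C * t) * C))
        (convex_Icc a T) ((hy.mono hsub).mul (by fun_prop))
        (fun t ht => ?_) (fun t ht => ?_) <;> rw [interior_Icc] at *
      · refine ((hder t (Ioo_subset_Ico_self ht)).mono (Ioo_subset_Icc_self.trans hsub)).mul ?_
        have := ((hasDerivAt_id t).const_mul C).exp
        simp only [id, mul_one] at this
        exact this.hasDerivWithinAt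
      · obtain ⟨h1, h2, h3, h4⟩ := hbefore t (Ioo_subset_Ico_self ht)
        have := neg_mul_le_of_barrier_nonneg hα hn ha (hsub (Ioo_subset_Icc_self ht)) h1.le h3.le h4.le
        rw [← hC] at this
        have h5 : 0 ≤ (v t + C * y t) * Real.exp (C * t) :=
          mul_nonneg (by linarith) (Real.exp_pos _).le
        linarith
    have h := hmono (left_mem_Icc.2 haT.le) (right_mem_Icc.2 haT.le) haT.le
    exact pos_of_mul_pos_left ((mul_pos h0.1 (Real.exp_pos _)).trans_le h) (Real.exp_pos _).le
  obtain ⟨hdy, hdv⟩ := hode' T hT hTy.le hTM.le hTv hTb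
  replace hdy := hdy.mono hsub
  replace hdv := hdv.mono hsub
  have hT1 : 1 < T := ha.trans haT
  have hTv' : v T < 0 := by
    refine hTv.lt_of_ne fun hv0 => ?_
    have := nonpos_of_hasDerivWithinAt_of_pos haT hdv.neg (by simp [hv0])
      (fun t ht => by simpa using (hbefore t ht).2.2.1)
    have hneg : profileAccel α n p T (y T) (v T) < 0 := by
      unfold profileAccel
      rw [hv0, mul_zero, add_zero]
      refine div_neg_of_neg_of_pos ?_ (by nlinarith)
      have h1 := hM (y T) hTy hTM
      have h2 : y T ^ p = y T ^ (p - 1) * y T := by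
        rw [← Real.rpow_add_one hTy.ne']; ring_nf
      rw [h2]
      nlinarith
    linarith
  refine hTfail ⟨hTy, hTM, hTv', hTb.lt_of_ne fun hb0 => ?_⟩
  have hd : HasDerivWithinAt (fun t => barrier α n t (y t) (v t))
      ((6 * T ^ 2 - 2) * v T + 2 * T * (T ^ 2 - 1) * profileAccel α n p T (y T) (v T)
      + (2 * (1 + 2 * α) * T * y T + ((1 + 2 * α) * T ^ 2 - n) * v T)) (Icc a T) T := by
    unfold barrier
    have e1 : HasDerivWithinAt (fun t : ℝ => 2 * t * (t ^ 2 - 1)) (6 * T ^ 2 - 2) (Icc a T) T := by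
      have := (((hasDerivAt_id T).const_mul 2).mul (((hasDerivAt_id T).pow 2).sub_const 1))
      refine (this.congr_deriv ?_).hasDerivWithinAt
      simp
      ring
    have e2 : HasDerivWithinAt (fun t : ℝ => (1 + 2 * α) * t ^ 2 - n) (2 * (1 + 2 * α) * T)
        (Icc a T) T := by
      have := (((hasDerivAt_id T).pow 2).const_mul (1 + 2 * α)).sub_const n
      refine (this.congr_deriv ?_).hasDerivWithinAt
      simp
      ring
    exact (e1.mul hdv).add (e2.mul hdy)
  have h1 := nonpos_of_hasDerivWithinAt_of_pos haT hd hb0.symm fun t ht => (hbefore t ht).2.2.2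
  exact absurd (barrier_deriv_pos (p := p) hT1 hTy (hpoly T haT.le) hb0.symm) (not_lt.2 h1)

lemma contDiffAt_profileField {α n p : ℝ} (hp : 1 < p) {z : ℝ × (ℝ × ℝ)} (hz : 1 < z.1) :
    ContDiffAt ℝ 1 (fun z : ℝ × (ℝ × ℝ) => profileField α n p z.1 z.2) z := by
  have hpow : ContDiff ℝ 1 fun x : ℝ => x ^ p :=
    Real.contDiff_rpow_const_of_le (n := 1) (by exact_mod_cast hp.le)
  have h0 : z.1 ≠ 0 := by linarith
  have h1 : z.1 ^ 2 - 1 ≠ 0 := by nlinarith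
  have hpz : ContDiffAt ℝ 1 (fun z : ℝ × (ℝ × ℝ) => z.2.1 ^ p) z :=
    hpow.contDiffAt.comp z (f := fun z : ℝ × (ℝ × ℝ) => z.2.1) (by fun_prop)
  unfold profileField profileAccel
  refine ContDiffAt.prodMk (by fun_prop) (ContDiffAt.div ?_ (by fun_prop) h1)
  have hdiv : ContDiffAt ℝ 1 (fun z : ℝ × (ℝ × ℝ) => (n + 1) / z.1) z :=
    ContDiffAt.div (by fun_prop) (by fun_prop) h0
  fun_prop

lemma exists_lipschitzOnWith_profileField {α n p a b M k : ℝ} (hp : 1 < p) (ha : 1 < a) :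
    ∃ K C : ℝ≥0, ∀ t ∈ Icc a b,
      LipschitzOnWith K (profileField α n p t) (Icc 0 M ×ˢ Icc (-k) 0) ∧
      ∀ x ∈ Icc 0 M ×ˢ Icc (-k) 0, ‖profileField α n p t x‖ ≤ C := by
  have hS : IsCompact (Icc a b ×ˢ (Icc 0 M ×ˢ Icc (-k) 0)) :=
    isCompact_Icc.prod (isCompact_Icc.prod isCompact_Icc)
  have hsm : ∀ z ∈ Icc a b ×ˢ (Icc 0 M ×ˢ Icc (-k) 0),
      ContDiffAt ℝ 1 (fun z : ℝ × (ℝ × ℝ) => profileField α n p z.1 z.2) z := fun z hz =>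
    contDiffAt_profileField hp (ha.trans_le hz.1.1)
  have hloc : LocallyLipschitzOn (Icc a b ×ˢ (Icc 0 M ×ˢ Icc (-k) 0))
      (fun z : ℝ × (ℝ × ℝ) => profileField α n p z.1 z.2) := fun z hz => by
    obtain ⟨K, t, ht, h⟩ := (hsm z hz).exists_lipschitzOnWith
    exact ⟨K, t, mem_nhdsWithin_of_mem_nhds ht, h⟩
  obtain ⟨K, hK⟩ := hloc.exists_lipschitzOnWith_of_compact hS
  obtain ⟨C, hC⟩ := hS.exists_bound_of_continuousOn
    fun z hz => (hsm z hz).continuousAt.continuousWithinAt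
  refine ⟨K, C.toNNReal, fun t ht => ⟨fun x hx x' hx' => ?_, fun x hx => ?_⟩⟩
  · have := hK (x := (t, x)) ⟨ht, hx⟩ (y := (t, x')) ⟨ht, hx'⟩
    simpa [Prod.edist_eq] using this
  · exact (hC (t, x) ⟨ht, hx⟩).trans (Real.le_coe_toNNReal C)

lemma IsProfileSol.mono {α n p M a b c : ℝ} {y v : ℝ → ℝ} (h : IsProfileSol α n p M a c y v)
    (hbc : b ≤ c) : IsProfileSol α n p M a b y v := fun t ht =>
  have hsub := Icc_subset_Icc_right hbc
  ⟨(h t (hsub ht)).1, (h t (hsub ht)).2.1.mono hsub, (h t (hsub ht)).2.2.mono hsub⟩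

lemma IsProfileSol.mem_box {α n p M a b : ℝ} {y v : ℝ → ℝ} (hα : 0 < α) (hn : 0 < n)
    (ha : 1 < a) (h : IsProfileSol α n p M a b y v) {t : ℝ} (ht : t ∈ Icc a b) :
    (y t, v t) ∈ Icc 0 M ×ˢ Icc (-((1 + 2 * α) * b ^ 2 / (2 * a * (a ^ 2 - 1)) * M)) 0 := by
  obtain ⟨h1, h2, h3, h4⟩ := (h t ht).1
  refine ⟨⟨h1.le, h2.le⟩,
    le_trans ?_ (neg_mul_le_of_barrier_nonneg hα hn ha ht h1.le h3.le h4.le), h3.le⟩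
  have : 0 < a ^ 2 - 1 := by nlinarith
  rw [neg_le_neg_iff]
  gcongr

lemma IsProfileSol.unique {α n p M a b : ℝ} {y v y' v' : ℝ → ℝ} (hα : 0 < α) (hn : 0 < n)
    (ha : 1 < a) (hp : 1 < p) (h : IsProfileSol α n p M a b y v)
    (h' : IsProfileSol α n p M a b y' v') (hy : y a = y' a) (hv : v a = v' a) :
    ∀ t ∈ Icc a b, y t = y' t ∧ v t = v' t := by
  obtain ⟨K, _, hK⟩ := exists_lipschitzOnWith_profileField (α := α) (n := n) (b := b) (M := M)
    (k := (1 + 2 * α) * b ^ 2 / (2 * a * (a ^ 2 - 1)) * M) hp ha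
  have hd : ∀ {y v : ℝ → ℝ}, IsProfileSol α n p M a b y v → ∀ t ∈ Icc a b,
      HasDerivWithinAt (fun t => (y t, v t)) (profileField α n p t (y t, v t)) (Icc a b) t :=
    fun h t ht => (h t ht).2.1.prodMk (h t ht).2.2
  have hr : ∀ {y v : ℝ → ℝ}, IsProfileSol α n p M a b y v → ∀ t ∈ Ico a b,
      HasDerivWithinAt (fun t => (y t, v t)) (profileField α n p t (y t, v t)) (Ici t) t :=
    fun h t ht => (hd h t (Ico_subset_Icc_self ht)).mono_of_mem_nhdsWithin
      (Icc_mem_nhdsGE_of_mem ht)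
  have := ODE_solution_unique_of_mem_Icc_right (v := profileField α n p)
    (fun t ht => (hK t (Ico_subset_Icc_self ht)).1)
    (fun t ht => (hd h t ht).continuousWithinAt) (hr h)
    (fun t ht => h.mem_box hα hn ha (Ico_subset_Icc_self ht))
    (fun t ht => (hd h' t ht).continuousWithinAt) (hr h')
    (fun t ht => h'.mem_box hα hn ha (Ico_subset_Icc_self ht)) (by simp [hy, hv])
  exact fun t ht => Prod.mk.injEq _ _ _ _ ▸ this ht

lemma exists_isProfileSol {α n p M a b y₀ v₀ : ℝ} (hα : 0 < α) (hn : 0 < n)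
    (ha : 1 < a) (hp : 1 < p) (hab : a ≤ b)
    (hM : ∀ u, 0 < u → u < M → u ^ (p - 1) < α * (α + 1))
    (hpoly : ∀ t, a ≤ t → 0 < t ^ 4 + (n * (2 - 4 * α) - 4 - 4 * α + 4 * α ^ 2) * t ^ 2 + n ^ 2)
    (h0 : InRegion α n M a y₀ v₀) :
    ∃ y v : ℝ → ℝ, y a = y₀ ∧ v a = v₀ ∧ IsProfileSol α n p M a b y v := by
  have hM0 : 0 ≤ M := (h0.1.trans h0.2.1).le
  set k := (1 + 2 * α) * b ^ 2 / (2 * a * (a ^ 2 - 1)) * M with hk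
  have hk0 : -k ≤ 0 := by
    have : 0 < a ^ 2 - 1 := by nlinarith
    rw [neg_nonpos]
    positivity
  obtain ⟨K, C, hK⟩ := exists_lipschitzOnWith_profileField (α := α) (n := n) (b := b) (M := M)
    (k := k) hp ha
  let clamp : ℝ × ℝ → ℝ × ℝ := fun x => (projIcc 0 M hM0 x.1, projIcc (-k) 0 hk0 x.2)
  have hclamp : LipschitzWith 1 clamp := by
    have h1 : LipschitzWith 1 fun x : ℝ × ℝ => (projIcc 0 M hM0 x.1 : ℝ) := by
      simpa [Function.comp_def] using LipschitzWith.subtype_val _ |>.comp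
        ((LipschitzWith.projIcc hM0).comp LipschitzWith.prod_fst)
    have h2 : LipschitzWith 1 fun x : ℝ × ℝ => (projIcc (-k) 0 hk0 x.2 : ℝ) := by
      simpa [Function.comp_def] using LipschitzWith.subtype_val _ |>.comp
        ((LipschitzWith.projIcc hk0).comp LipschitzWith.prod_snd)
    simpa using h1.prodMk h2
  have hmem : ∀ x, clamp x ∈ Icc 0 M ×ˢ Icc (-k) 0 := fun x => ⟨Subtype.prop _, Subtype.prop _⟩
  obtain ⟨x, hx0, hx⟩ := exists_solution_of_lipschitz_of_bounded
    (f := fun t x => profileField α n p t (clamp x)) (K := K) (C := C) hab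
    (fun t ht => by
      have := (hK t ht).1.comp (hclamp.lipschitzOnWith (s := univ)) fun x _ => hmem x
      simpa [lipschitzOnWith_univ, Function.comp_def] using this)
    (fun x t ht => by
      have := (contDiffAt_profileField (α := α) (n := n) (z := (t, clamp x)) hp
        (ha.trans_le ht.1)).continuousAt
      exact (this.comp (f := fun t => (t, clamp x)) (by fun_prop)).continuousWithinAt)
    (fun t ht x => (hK t ht).2 _ (hmem x)) (y₀, v₀)
  have hxc : ContinuousOn x (Icc a b) := fun t ht => (hx t ht).continuousWithinAt
  have hx0' : (x a).1 = y₀ ∧ (x a).2 = v₀ := by simp [hx0]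
  refine ⟨fun t => (x t).1, fun t => (x t).2, hx0'.1, hx0'.2,
    isProfileSol_of_inRegion_left hα hn ha hM hpoly (by fun_prop) (by fun_prop)
      (fun t ht h1 h2 h3 h4 => ?_) (by simpa [hx0] using h0)⟩
  have hc : clamp (x t) = x t := by
    simp only [clamp]
    rw [projIcc_of_mem hM0 ⟨h1, h2⟩, projIcc_of_mem hk0 ⟨h4, h3⟩]
  have := hx t ht
  rw [hc] at this
  have hL := hasDerivWithinAt_iff_hasFDerivWithinAt.1 this
  constructor
  · simpa [profileField] using hL.fst.hasDerivWithinAt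
  · simpa [profileField] using hL.snd.hasDerivWithinAt

/-- The trajectory through a point of the invariant region exists for all later times. -/
lemma exists_global_isProfileSol {α n p M a y₀ v₀ : ℝ} (hα : 0 < α) (hn : 0 < n)
    (ha : 1 < a) (hp : 1 < p)
    (hM : ∀ u, 0 < u → u < M → u ^ (p - 1) < α * (α + 1))
    (hpoly : ∀ t, a ≤ t → 0 < t ^ 4 + (n * (2 - 4 * α) - 4 - 4 * α + 4 * α ^ 2) * t ^ 2 + n ^ 2)
    (h0 : InRegion α n M a y₀ v₀) :
    ∃ y v : ℝ → ℝ, y a = y₀ ∧ v a = v₀ ∧ ∀ b, IsProfileSol α n p M a b y v := by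
  have hex : ∀ b : ℝ, ∃ x : (ℝ → ℝ) × (ℝ → ℝ), x.1 a = y₀ ∧ x.2 a = v₀ ∧
      IsProfileSol α n p M a (max a b) x.1 x.2 := fun b => by
    obtain ⟨y, v, h⟩ := exists_isProfileSol (b := max a b) hα hn ha hp (le_max_left _ _) hM hpoly h0
    exact ⟨(y, v), h⟩
  choose x hxy hxv hx using hex
  have heq : ∀ b, ∀ t ∈ Icc a b, (x t).1 t = (x b).1 t ∧ (x t).2 t = (x b).2 t := fun b t ht => by
    refine IsProfileSol.unique hα hn ha hp (hx t) ((hx b).mono (max_le_max_left a ht.2))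
      (by rw [hxy, hxy]) (by rw [hxv, hxv]) t ⟨ht.1, le_max_right _ _⟩
  refine ⟨fun t => (x t).1 t, fun t => (x t).2 t, hxy a, hxv a, fun b t ht => ?_⟩
  obtain ⟨h1, h2, h3⟩ := ((hx b).mono (le_max_right a b)) t ht
  obtain ⟨e1, e2⟩ := heq b t ht
  simp only [e1, e2]
  exact ⟨h1, h2.congr (fun s hs => (heq b s hs).1) e1, h3.congr (fun s hs => (heq b s hs).2) e2⟩

lemma alphaP_bounds {N : ℕ} {p : ℝ}
    (hNp : (N = 3 ∧ 5 < p) ∨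
      (4 ≤ N ∧ 1 + 4 / ((N : ℝ) - 2) < p ∧ p ≤ 1 + 4 / ((N : ℝ) - 3))) :
    1 < p ∧ 1 ≤ (N : ℝ) - 2 ∧ 0 < alphaP p ∧ (N : ℝ) - 3 ≤ 2 * alphaP p ∧
      2 * alphaP p < (N : ℝ) - 2 := by
  unfold alphaP
  rcases hNp with ⟨rfl, hp⟩ | ⟨hN, h1, h2⟩
  · have hp1 : 0 < p - 1 := by linarith
    refine ⟨by linarith, by norm_num, by positivity, ?_, ?_⟩
    · have : 0 < 2 / (p - 1) := by positivity
      push_cast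
      linarith
    · rw [← mul_div_assoc, div_lt_iff₀ hp1]
      push_cast
      linarith
  · have hN' : (4 : ℝ) ≤ N := by exact_mod_cast hN
    have hn : 0 < (N : ℝ) - 2 := by linarith
    have hn' : 0 < (N : ℝ) - 3 := by linarith
    have h3 : 0 < 4 / ((N : ℝ) - 2) := by positivity
    have hp1 : 0 < p - 1 := by linarith
    refine ⟨by linarith, by linarith, by positivity, ?_, ?_⟩
    · have : p - 1 ≤ 4 / ((N : ℝ) - 3) := by linarith
      rw [le_div_iff₀ hn'] at this
      rw [← mul_div_assoc, le_div_iff₀ hp1]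
      linarith
    · have : 4 / ((N : ℝ) - 2) < p - 1 := by linarith
      rw [div_lt_iff₀ hn] at this
      rw [← mul_div_assoc, div_lt_iff₀ hp1]
      linarith

lemma betaNP_eq (N : ℕ) {p : ℝ} (hp : 1 < p) :
    betaNP N p = ((N : ℝ) - 2) * (2 - 4 * alphaP p) - 4 - 4 * alphaP p + 4 * alphaP p ^ 2 := by
  have : p - 1 ≠ 0 := by linarith
  unfold betaNP alphaP
  field_simp
  ring

lemma quartic_pos_of_rhoNP_lt {N : ℕ} {p t : ℝ} (hn : 0 < (N : ℝ) - 2)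
    (hβ : betaNP N p ≤ -2 * ((N : ℝ) - 2)) (h : rhoNP N p < t) :
    0 < t ^ 4 + betaNP N p * t ^ 2 + ((N : ℝ) - 2) ^ 2 := by
  unfold rhoNP at h
  generalize betaNP N p = β at *
  generalize (N : ℝ) - 2 = n at *
  have hD : 0 ≤ β ^ 2 - 4 * n ^ 2 := by nlinarith
  have hs0 := Real.sqrt_nonneg (β ^ 2 - 4 * n ^ 2)
  have hs2 := Real.sq_sqrt hD
  set s := Real.sqrt (β ^ 2 - 4 * n ^ 2)
  have hsβ : 0 < -β - s := by
    by_contra! hcon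
    nlinarith [sq_nonneg n]
  set q := (-β - s) / (2 * n ^ 2) with hq
  have hq0 : 0 < q := by positivity
  have hqt : 1 < q * t ^ 2 := by
    have h1 : 1 < √q * t := by
      rwa [inv_lt_iff_one_lt_mul₀' (Real.sqrt_pos.2 hq0)] at h
    have := one_lt_pow₀ h1 two_ne_zero
    rwa [mul_pow, Real.sq_sqrt hq0.le] at this
  have h2 : 2 * n ^ 2 < (-β - s) * t ^ 2 := by
    rw [hq, div_mul_eq_mul_div, one_lt_div (by positivity)] at hqt
    exact hqt
  have h3 : -β + s < 2 * t ^ 2 := by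
    have : (-β - s) * (-β + s) < (-β - s) * (2 * t ^ 2) := by nlinarith
    exact lt_of_mul_lt_mul_left this hsβ.le
  have h4 : 0 < (2 * t ^ 2 + β - s) * (2 * t ^ 2 + β + s) :=
    mul_pos (by linarith) (by linarith)
  nlinarith

lemma rpow_lt_of_lt_bInf {N : ℕ} {p u : ℝ} (hp : 1 < p) (hα : 0 < alphaP p)
    (h1 : (N : ℝ) - 3 ≤ 2 * alphaP p) (h2 : 2 * alphaP p < (N : ℝ) - 2) (hu : 0 < u)
    (hub : u < bInf N p) : u ^ (p - 1) < alphaP p * (alphaP p + 1) := by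
  have hp1 : 0 < p - 1 := by linarith
  have hγ : 0 ≤ alphaP p * ((N : ℝ) - 2 - alphaP p) := mul_nonneg hα.le (by linarith)
  have he : alphaP p / 2 * (p - 1) = 1 := by
    unfold alphaP
    field_simp
  calc u ^ (p - 1) < bInf N p ^ (p - 1) := Real.rpow_lt_rpow hu.le hub hp1
    _ = alphaP p * ((N : ℝ) - 2 - alphaP p) := by
      rw [bInf, ← Real.rpow_mul hγ, he, Real.rpow_one]
    _ ≤ alphaP p * (alphaP p + 1) := by
      gcongr
      linarith

lemma neg_Btilde_lt_iff {N : ℕ} {p t u v : ℝ} (hp : 1 < p) (ht : 1 < t) (hu : 0 < u) :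
    -Btilde N p t / 2 < t * v / u ↔ 0 < barrier (alphaP p) ((N : ℝ) - 2) t u v := by
  have hp1 : p - 1 ≠ 0 := by linarith
  have ht2 : 0 < t ^ 2 - 1 := by nlinarith
  have ht0 : 0 < t := by linarith
  have h1 : 1 - 1 / t ^ 2 ≠ 0 := by
    have : 1 - 1 / t ^ 2 = (t ^ 2 - 1) / t ^ 2 := by field_simp
    rw [this]
    positivity
  have hB : Btilde N p t = ((1 + 2 * alphaP p) * t ^ 2 - ((N : ℝ) - 2)) / (t ^ 2 - 1) := by
    unfold Btilde alphaP
    rw [div_eq_div_iff h1 ht2.ne']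
    field_simp
    ring
  have key : t * v / u - -Btilde N p t / 2 =
      barrier (alphaP p) ((N : ℝ) - 2) t u v / (2 * (t ^ 2 - 1) * u) := by
    rw [hB]
    unfold barrier
    field_simp
    ring
  rw [← sub_pos, key, div_pos_iff_of_pos_right (by positivity)]

lemma profile_eq_iff {N : ℕ} {p t u v w : ℝ} (hp : 1 < p) (ht : 1 < t) (hu : 0 ≤ u) :
    (1 - t ^ 2) * w + (((N : ℝ) - 1) / t - 2 * (alphaP p + 1) * t) * v
      - alphaP p * (alphaP p + 1) * u + |u| ^ (p - 1) * u = 0 ↔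
    w = profileAccel (alphaP p) ((N : ℝ) - 2) p t u v := by
  have ht2 : t ^ 2 - 1 ≠ 0 := by nlinarith
  have hpow : |u| ^ (p - 1) * u = u ^ p := by
    rw [abs_of_nonneg hu, ← Real.rpow_add_one' hu (by linarith), sub_add_cancel]
  rw [hpow, profileAccel, eq_div_iff ht2, show (N : ℝ) - 2 + 1 = N - 1 by ring]
  constructor <;> intro h <;> linarith

lemma contDiffAt_of_hasDerivAt_profileAccel {α n p a : ℝ} {y v : ℝ → ℝ} (hp : 1 < p) (ha : 1 < a)
    (hy : ∀ t, a < t → HasDerivAt y (v t) t)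
    (hv : ∀ t, a < t → HasDerivAt v (profileAccel α n p t (y t) (v t)) t) {x : ℝ} (hx : a < x) :
    ContDiffAt ℝ 2 y x := by
  refine ContDiffOn.contDiffAt (s := Ioi a) ?_ (Ioi_mem_nhds hx)
  rw [show (2 : WithTop ℕ∞) = 1 + 1 by norm_num, contDiffOn_succ_iff_deriv_of_isOpen isOpen_Ioi]
  refine ⟨fun t ht => (hy t ht).differentiableAt.differentiableWithinAt, by simp, ?_⟩
  refine ContDiffOn.congr (f := v) ?_ fun t ht => (hy t ht).deriv
  rw [show (1 : WithTop ℕ∞) = 0 + 1 by norm_num, contDiffOn_succ_iff_deriv_of_isOpen isOpen_Ioi]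
  refine ⟨fun t ht => (hv t ht).differentiableAt.differentiableWithinAt, by simp, ?_⟩
  rw [contDiffOn_zero]
  refine ContinuousOn.congr (f := fun t => (profileField α n p t (y t, v t)).2) ?_
    fun t ht => (hv t ht).deriv
  intro t ht
  have := (contDiffAt_profileField (α := α) (n := n) (z := (t, (y t, v t))) hp
    (ha.trans ht)).continuousAt
  have hyc := (hy t ht).continuousAt
  have hvc := (hv t ht).continuousAt
  exact (this.comp (f := fun t => (t, (y t, v t)))
    (continuousAt_id.prodMk (hyc.prodMk hvc))).snd.continuousWithinAt

theorem stmt19 (N : ℕ) (p : ℝ)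
    (hNp : (N = 3 ∧ 5 < p) ∨
      (4 ≤ N ∧ 1 + 4 / ((N : ℝ) - 2) < p ∧ p ≤ 1 + 4 / ((N : ℝ) - 3))) :
    betaNP N p ≤ -2 * ((N : ℝ) - 2) ∧
    ∀ (ρ₀ τ σ : ℝ) (U : ℝ → ℝ), 1 < ρ₀ → τ < ρ₀ → ρ₀ < σ →
      ContDiffOn ℝ 2 U (Ioo τ σ) → IsSolOn N p U (Ioo τ σ) →
      0 < U ρ₀ → U ρ₀ < bInf N p → deriv U ρ₀ < 0 →
      -Btilde N p ρ₀ / 2 < ρ₀ * deriv U ρ₀ / U ρ₀ →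
      rhoNP N p < ρ₀ →
      -- the forward maximal solution through `ρ₀` is global (`ρ₊ = +∞`) …
      ∃ V : ℝ → ℝ,
        EqOn V U (Ico ρ₀ σ) ∧
        ContDiffOn ℝ 2 V (Ici ρ₀) ∧
        IsSolOn N p V (Ioi ρ₀) ∧
        -- … and stays positive with the stated logarithmic-derivative bound
        ∀ x : ℝ, ρ₀ < x → 0 < V x ∧ -Btilde N p x / 2 < x * deriv V x / V x := by
  obtain ⟨hp, hn1, hα, hα1, hα2⟩ := alphaP_bounds hNp
  have hn : 0 < (N : ℝ) - 2 := by linarith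
  have hβ : betaNP N p ≤ -2 * ((N : ℝ) - 2) := by
    rw [betaNP_eq N hp]
    nlinarith [mul_nonneg (sub_nonneg.2 hα1) (sub_nonneg.2 hα2.le)]
  refine ⟨hβ, ?_⟩
  intro ρ₀ τ σ U h1 hτ hσ hU hsol hU0 hUb hU' hB hρ
  have hM : ∀ u, 0 < u → u < bInf N p → u ^ (p - 1) < alphaP p * (alphaP p + 1) :=
    fun u => rpow_lt_of_lt_bInf hp hα hα1 hα2
  have hpoly : ∀ t, ρ₀ ≤ t → 0 < t ^ 4 + (((N : ℝ) - 2) * (2 - 4 * alphaP p) - 4 - 4 * alphaP p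
      + 4 * alphaP p ^ 2) * t ^ 2 + ((N : ℝ) - 2) ^ 2 := fun t ht => by
    rw [← betaNP_eq N hp]
    exact quartic_pos_of_rhoNP_lt hn hβ (hρ.trans_le ht)
  have h0 : InRegion (alphaP p) ((N : ℝ) - 2) (bInf N p) ρ₀ (U ρ₀) (deriv U ρ₀) :=
    ⟨hU0, hUb, hU', (neg_Btilde_lt_iff hp h1 hU0).1 hB⟩
  obtain ⟨y, v, hy0, hv0, hyv⟩ := exists_global_isProfileSol hα hn h1 hp hM hpoly h0
  have hder : ∀ t, ρ₀ < t → HasDerivAt y (v t) t ∧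
      HasDerivAt v (profileAccel (alphaP p) ((N : ℝ) - 2) p t (y t) (v t)) t := fun t ht => by
    have hnhds : Icc ρ₀ (t + 1) ∈ 𝓝 t := Icc_mem_nhds ht (by linarith)
    obtain ⟨-, h2, h3⟩ := hyv (t + 1) t ⟨ht.le, by linarith⟩
    exact ⟨h2.hasDerivAt hnhds, h3.hasDerivAt hnhds⟩
  have hUc : ∀ t ∈ Ioo τ σ, ContDiffAt ℝ 2 U t := fun t ht =>
    hU.contDiffAt (isOpen_Ioo.mem_nhds ht)
  have hUd : ∀ t ∈ Ioo τ σ, HasDerivAt U (deriv U t) t := fun t ht =>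
    ((hUc t ht).differentiableAt two_ne_zero).hasDerivAt
  have hUdd : ∀ t ∈ Ioo τ σ, HasDerivAt (deriv U) (deriv (deriv U) t) t := fun t ht => by
    have : ContDiffOn ℝ (1 + 1) U (Ioo τ σ) := by simpa [one_add_one_eq_two] using hU
    have := ((contDiffOn_succ_iff_deriv_of_isOpen isOpen_Ioo).1 this).2.2
    exact ((this.contDiffAt (isOpen_Ioo.mem_nhds ht)).differentiableAt one_ne_zero).hasDerivAt
  have hUy : ∀ t ∈ Ico ρ₀ σ, U t = y t := fun b hb => by
    have hsub : Icc ρ₀ b ⊆ Ioo τ σ := fun t ht => ⟨hτ.trans_le ht.1, ht.2.trans_lt hb.2⟩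
    have hUsol : IsProfileSol (alphaP p) ((N : ℝ) - 2) p (bInf N p) ρ₀ b U (deriv U) := by
      refine isProfileSol_of_inRegion_left hα hn h1 hM hpoly
        (fun t ht => (hUd t (hsub ht)).continuousAt.continuousWithinAt)
        (fun t ht => (hUdd t (hsub ht)).continuousAt.continuousWithinAt)
        (fun t ht h2 _ _ _ => ⟨(hUd t (hsub ht)).hasDerivWithinAt, ?_⟩) h0
      rw [← (profile_eq_iff hp (h1.trans_le ht.1) h2).1 (hsol t (hsub ht))]
      exact (hUdd t (hsub ht)).hasDerivWithinAt
    exact (hUsol.unique hα hn h1 hp (hyv b) hy0.symm hv0.symm b ⟨hb.1, le_rfl⟩).1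
  let V : ℝ → ℝ := fun t => if t ≤ ρ₀ then U t else y t
  have hVU : EqOn V U (Iio σ) := fun t ht => by
    by_cases h : t ≤ ρ₀
    · simp [V, h]
    · simp [V, h, hUy t ⟨(not_le.1 h).le, ht⟩]
  have hVy : EqOn V y (Ioi ρ₀) := fun t ht => by simp [V, not_le.2 (mem_Ioi.1 ht)]
  have hV' : EqOn (deriv V) v (Ioi ρ₀) := fun t ht => by
    rw [(hVy.eventuallyEq_of_mem (Ioi_mem_nhds ht)).deriv_eq, (hder t ht).1.deriv]
  have hV'' : ∀ t, ρ₀ < t → deriv (deriv V) t =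
      profileAccel (alphaP p) ((N : ℝ) - 2) p t (y t) (v t) := fun t ht => by
    rw [(hV'.eventuallyEq_of_mem (Ioi_mem_nhds ht)).deriv_eq, (hder t ht).2.deriv]
  have hreg : ∀ t, ρ₀ < t → InRegion (alphaP p) ((N : ℝ) - 2) (bInf N p) t (y t) (v t) :=
    fun t ht => (hyv t t ⟨ht.le, le_rfl⟩).1
  refine ⟨V, hVU.mono Ico_subset_Iio_self, fun x hx => ?_, fun t ht => ?_, fun x hx => ?_⟩
  · rcases eq_or_lt_of_le (mem_Ici.1 hx) with rfl | hx
    · exact ((hUc ρ₀ ⟨hτ, hσ⟩).congr_of_eventuallyEq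
        (hVU.eventuallyEq_of_mem (Iio_mem_nhds hσ))).contDiffWithinAt
    · exact ((contDiffAt_of_hasDerivAt_profileAccel hp h1 (fun t ht => (hder t ht).1)
        (fun t ht => (hder t ht).2) hx).congr_of_eventuallyEq
        (hVy.eventuallyEq_of_mem (Ioi_mem_nhds hx))).contDiffWithinAt
  · rw [hV'' t ht, hV' ht, hVy ht]
    exact (profile_eq_iff hp (h1.trans ht) (hreg t ht).1.le).2 rfl
  · obtain ⟨h2, -, -, h3⟩ := hreg x hx
    rw [hV' hx, hVy hx]
    exact ⟨h2, (neg_Btilde_lt_iff hp (h1.trans hx) h2).2 h3⟩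
end
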